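/- Membership in TRR∀ (the class of finite rule sets Σ such that every restricted chase sequence of ⟨Σ, D⟩ is finite for every database D) is Π¹₁-hard. -/

import Mathlib

/-!
Common formalization framework for "Restricted Chase Termination: You Want More than Fairness"
(Carral, Gerlach, Larroque, Thomazo).

Syntax is encoded over natural numbers so that all finite objects (rules, databases, knowledge
bases, Turing machines) live in `Primcodable` types, which allows us to speak about
many-one reductions and about the arithmetical/analytical hierarchy.
-/

namespace ChaseTermination

/-! ### Terms, atoms, facts, rules, knowledge bases -/

/-- Ground terms: `Sum.inl c` is the constant `c`, `Sum.inr n` is the null `n`. -/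
abbrev GroundTerm : Type := ℕ ⊕ ℕ

/-- Terms of rules: `Sum.inl v` is the variable `v`, `Sum.inr g` a ground term. -/
abbrev RTerm : Type := ℕ ⊕ GroundTerm

/-- A fact: a predicate (coded by a natural number) applied to ground terms. -/
abbrev Fact : Type := ℕ × List GroundTerm

/-- An atom: a predicate applied to terms. -/
abbrev Atom : Type := ℕ × List RTerm

/-- An existential rule, given by its body and its head (lists of atoms);
the universally quantified variables are those occurring in the body, the existentially
quantified ones are the head variables not occurring in the body. -/
abbrev Rule : Type := List Atom × List Atom

abbrev RuleSet : Type := List Rule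

abbrev Database : Type := List Fact

/-- A knowledge base: a (finite) rule set together with a database. -/
abbrev KB : Type := RuleSet × Database

def atomHasVar (a : Atom) (v : ℕ) : Prop := (Sum.inl v : RTerm) ∈ a.2

def atomNullFree (a : Atom) : Prop := ∀ t ∈ a.2, ∀ n : ℕ, t ≠ Sum.inr (Sum.inr n)

def factNullFree (f : Fact) : Prop := ∀ t ∈ f.2, ∀ n : ℕ, t ≠ Sum.inr n

/-- A database is a finite fact set without nulls. -/
def IsDatabase (D : Database) : Prop := ∀ f ∈ D, factNullFree f

/-- Well-formed rule: non-empty head, no nulls. -/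
def IsRule (r : Rule) : Prop := r.2 ≠ [] ∧ ∀ a ∈ r.1 ++ r.2, atomNullFree a

def IsRuleSet (S : RuleSet) : Prop := ∀ r ∈ S, IsRule r

def IsKB (kb : KB) : Prop := IsRuleSet kb.1 ∧ IsDatabase kb.2

/-- `v` occurs in the body of `r` (i.e. is universally quantified). -/
def bodyVar (r : Rule) (v : ℕ) : Prop := ∃ a ∈ r.1, atomHasVar a v

/-- `v` is an existential variable of `r`. -/
def existVar (r : Rule) (v : ℕ) : Prop := (∃ a ∈ r.2, atomHasVar a v) ∧ ¬ bodyVar r v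

def applyT (σ : ℕ → GroundTerm) : RTerm → GroundTerm
  | Sum.inl v => σ v
  | Sum.inr g => g

def applyA (σ : ℕ → GroundTerm) (a : Atom) : Fact := (a.1, a.2.map (applyT σ))

/-- A trigger: a rule together with a substitution for its (universal) variables. -/
abbrev Trigger : Type := Rule × (ℕ → GroundTerm)

/-- The support of a trigger: the instantiated body. -/
def support (t : Trigger) : Set Fact := {f | ∃ a ∈ t.1.1, f = applyA t.2 a}

/-- A trigger is loaded for `F` if `F` includes its support. -/
def loaded (t : Trigger) (F : Set Fact) : Prop := ∀ a ∈ t.1.1, applyA t.2 a ∈ F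

/-- `σ'` agrees with the substitution of `t` on all universally quantified (body) variables. -/
def agreesOnBody (t : Trigger) (σ' : ℕ → GroundTerm) : Prop :=
  ∀ v, bodyVar t.1 v → σ' v = t.2 v

/-- A trigger is obsolete for `F` if some extension of its substitution to the existential
variables sends the head into `F`. -/
def obsolete (t : Trigger) (F : Set Fact) : Prop :=
  ∃ σ' : ℕ → GroundTerm, agreesOnBody t σ' ∧ ∀ a ∈ t.1.2, applyA σ' a ∈ F

/-- The (ground) terms occurring in a fact set. -/
def termsOf (F : Set Fact) : Set GroundTerm := {g | ∃ f ∈ F, g ∈ f.2}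

/-- `σ'` is a proper output extension of the trigger `t` w.r.t. `F`: it agrees with the trigger
substitution on body variables and maps existential variables to pairwise distinct fresh nulls. -/
def properExt (t : Trigger) (F : Set Fact) (σ' : ℕ → GroundTerm) : Prop :=
  agreesOnBody t σ' ∧
  (∀ v, existVar t.1 v → ∃ n : ℕ, σ' v = Sum.inr n ∧ (Sum.inr n : GroundTerm) ∉ termsOf F) ∧
  (∀ v w, existVar t.1 v → existVar t.1 w → σ' v = σ' w → v = w)

/-- The output of a trigger under an extended substitution. -/
def outputOf (t : Trigger) (σ' : ℕ → GroundTerm) : Set Fact := {f | ∃ a ∈ t.1.2, f = applyA σ' a}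

/-- An active trigger of `S` for `F`: loaded and not obsolete. -/
def Active (S : RuleSet) (F : Set Fact) (t : Trigger) : Prop :=
  t.1 ∈ S ∧ loaded t F ∧ ¬ obsolete t F

/-- One restricted chase step. -/
def ChaseStep (S : RuleSet) (F F' : Set Fact) : Prop :=
  ∃ t : Trigger, Active S F t ∧ ∃ σ', properExt t F σ' ∧ F' = F ∪ outputOf t σ'

def dbSet (D : Database) : Set Fact := {f | f ∈ D}

/-- A (possibly infinite) restricted chase derivation for `⟨S, D⟩`, of length `len ∈ ℕ∞`.
Beyond the length the fact sets stall, so that the result is always `⋃ i, fact i`. -/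
structure Chase (S : RuleSet) (D : Set Fact) where
  len : ℕ∞
  fact : ℕ → Set Fact
  trig : ℕ → Trigger
  ext : ℕ → ℕ → GroundTerm
  init : fact 0 = D
  activeAt : ∀ i : ℕ, (i : ℕ∞) < len → Active S (fact i) (trig i)
  extOk : ∀ i : ℕ, (i : ℕ∞) < len → properExt (trig i) (fact i) (ext i)
  succ : ∀ i : ℕ, (i : ℕ∞) < len → fact (i + 1) = fact i ∪ outputOf (trig i) (ext i)
  stall : ∀ i : ℕ, ¬ ((i : ℕ∞) < len) → fact (i + 1) = fact i

/-- Fairness: every trigger that becomes loaded is eventually obsolete.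
A fair chase derivation is a *restricted chase sequence*; note that for a finite derivation
fairness forces maximality (no active trigger remains at the end). -/
def Fair {S : RuleSet} {D : Set Fact} (c : Chase S D) : Prop :=
  ∀ t : Trigger, t.1 ∈ S → ∀ i : ℕ, loaded t (c.fact i) → ∃ j : ℕ, i ≤ j ∧ obsolete t (c.fact j)

/-- The result of a chase derivation. -/
def chaseResult {S : RuleSet} {D : Set Fact} (c : Chase S D) : Set Fact := ⋃ i, c.fact i

/-- The derivation is infinite (non-terminating). -/
def IsInfinite {S : RuleSet} {D : Set Fact} (c : Chase S D) : Prop := c.len = ⊤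

/-- `TKR∀`: knowledge bases all of whose restricted chase sequences are finite. -/
def TKRall (kb : KB) : Prop :=
  IsKB kb ∧ ¬ ∃ c : Chase kb.1 (dbSet kb.2), IsInfinite c ∧ Fair c

/-- `TRR∀`: rule sets universally terminating for the restricted chase on every database. -/
def TRRall (S : RuleSet) : Prop :=
  IsRuleSet S ∧ ∀ D : Database, IsDatabase D → ¬ ∃ c : Chase S (dbSet D), IsInfinite c ∧ Fair c

/-! ### Breadth-first chase -/

/-- The instance of a trigger: its rule together with its instantiated body (this determines the
substitution on all body variables). -/
def instOf (t : Trigger) : Rule × List Fact := (t.1, t.1.1.map (applyA t.2))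

/-- The set of instances of active triggers (this is what "the number of triggers that are loaded
and not obsolete" counts). -/
def activeInsts (S : RuleSet) (F : Set Fact) : Set (Rule × List Fact) :=
  {p | ∃ t : Trigger, Active S F t ∧ p = instOf t}

/-- The breadth-first condition (†): a trigger loaded at step `i` becomes obsolete within the
next `n` steps, where `n` is the number of active triggers at step `i`. -/
def BreadthFirst {S : RuleSet} {D : Set Fact} (c : Chase S D) : Prop :=
  ∀ i : ℕ, ∀ t : Trigger, t.1 ∈ S → loaded t (c.fact i) →
    ∃ j : ℕ, i ≤ j ∧ j ≤ i + (activeInsts S (c.fact i)).ncard ∧ obsolete t (c.fact j)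

/-- `TKRBF∀`: knowledge bases all of whose breadth-first chase sequences are finite. -/
def TKRBFall (kb : KB) : Prop :=
  IsKB kb ∧ ¬ ∃ c : Chase kb.1 (dbSet kb.2), IsInfinite c ∧ BreadthFirst c

/-- `TRRBF∀`: rule sets whose breadth-first chase terminates on every database. -/
def TRRBFall (S : RuleSet) : Prop :=
  IsRuleSet S ∧ ∀ D : Database, IsDatabase D →
    ¬ ∃ c : Chase S (dbSet D), IsInfinite c ∧ BreadthFirst c

/-! ### Classes of the arithmetical and analytical hierarchies -/

/-- `Π⁰₂` predicates, via the Kleene normal form `∀ m ∃ k. R`. -/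
def Pi02 {α : Type} [Primcodable α] (p : α → Prop) : Prop :=
  ∃ R : α × ℕ → ℕ → Bool, Computable₂ R ∧ ∀ a, p a ↔ ∀ m : ℕ, ∃ k : ℕ, R (a, m) k = true

/-- `Π¹₁` predicates, via the Kleene normal form: `p a` iff for every function `f : ℕ → ℕ` some
finite initial segment of `f` witnesses a computable predicate. -/
def Pi11 {α : Type} [Primcodable α] (p : α → Prop) : Prop :=
  ∃ R : α → List ℕ → Bool, Computable₂ R ∧
    ∀ a, p a ↔ ∀ f : ℕ → ℕ, ∃ k : ℕ, R a ((List.range k).map f) = true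

/-- `Π¹₁`-hardness: every `Π¹₁` problem many-one reduces to `p`. -/
def Pi11Hard {α : Type} [Primcodable α] (p : α → Prop) : Prop :=
  ∀ q : ℕ → Prop, Pi11 q → q ≤₀ p

def Pi11Complete {α : Type} [Primcodable α] (p : α → Prop) : Prop := Pi11 p ∧ Pi11Hard p

/-! ### Non-deterministic Turing machines -/

/-- A non-deterministic Turing machine `(numStates, alphaSize, table)`.
States are `0, …, numStates - 1` with initial state `0`; tape symbols `0, …, alphaSize - 1`
form `Γ` (so `{0,1} ⊆ Γ` iff `2 ≤ alphaSize`), and the blank `B` is coded by `alphaSize`.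
An entry `((q, a), (q', b, d))` means `(q', b, d) ∈ δ(q, a)`, with `d = true` for a right move
and `d = false` for a left move. -/
abbrev NTM : Type := ℕ × ℕ × List ((ℕ × ℕ) × (ℕ × ℕ × Bool))

def NTM.numStates (M : NTM) : ℕ := M.1
def NTM.blank (M : NTM) : ℕ := M.2.1
def NTM.table (M : NTM) : List ((ℕ × ℕ) × (ℕ × ℕ × Bool)) := M.2.2

/-- Well-formedness: `Γ ⊇ {0,1}`, transitions use valid states and symbols, and the machine
never writes the blank. -/
def NTM.WF (M : NTM) : Prop :=
  1 ≤ NTM.numStates M ∧ 2 ≤ NTM.blank M ∧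
    ∀ e ∈ NTM.table M, e.1.1 < NTM.numStates M ∧ e.1.2 ≤ NTM.blank M ∧
      e.2.1 < NTM.numStates M ∧ e.2.2.1 < NTM.blank M

/-- A configuration `(tape, p, q)`: tape contents (a list of symbol codes whose last cell is
blank and in which no proper symbol occurs after a blank), 0-based head position `p`,
and current state `q`. -/
abbrev Config : Type := List ℕ × ℕ × ℕ

def WFConfig (M : NTM) (ρ : Config) : Prop :=
  ρ.2.1 < ρ.1.length ∧ ρ.1.getLast? = some (NTM.blank M) ∧
    (∀ i j : ℕ, i ≤ j → j < ρ.1.length → ρ.1.getD i 0 = NTM.blank M →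
      ρ.1.getD j 0 = NTM.blank M) ∧
    (∀ a ∈ ρ.1, a ≤ NTM.blank M) ∧ ρ.2.2 < NTM.numStates M

/-- The one-step relation `Next_M` between configurations; each step extends the represented
part of the tape by one blank cell. -/
def NTM.Next (M : NTM) (ρ ρ' : Config) : Prop :=
  ∃ q' b : ℕ, ∃ d : Bool,
    ((ρ.2.2, ρ.1.getD ρ.2.1 0), (q', b, d)) ∈ NTM.table M ∧
    (d = true ∨ 1 ≤ ρ.2.1) ∧
    ρ' = (ρ.1.set ρ.2.1 b ++ [NTM.blank M], if d then ρ.2.1 + 1 else ρ.2.1 - 1, q')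

/-- The starting configuration of `M` on a word. -/
def startConfig (M : NTM) (w : List ℕ) : Config := (w ++ [NTM.blank M], 0, 0)

/-- Words are over the input alphabet `{0, 1}`. -/
def IsWord (w : List ℕ) : Prop := ∀ a ∈ w, a < 2

/-- There is a run of `M` starting in `ρ` that visits the state `qr` infinitely often.
(Such a run is necessarily infinite, and every infinite sequence of `Next_M`-successive
configurations is a run; finite runs trivially feature `qr` only finitely many times.) -/
def RecurringFrom (M : NTM) (qr : ℕ) (ρ : Config) : Prop :=
  ∃ c : ℕ → Config, c 0 = ρ ∧ (∀ i, NTM.Next M (c i) (c (i + 1))) ∧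
    ∀ N : ℕ, ∃ i : ℕ, N ≤ i ∧ (c i).2.2 = qr

/-- `M` is non-recurring through `qr` on the configuration `ρ`: every run of `M` on `ρ`
features `qr` only finitely many times. -/
def NonRecurringFrom (M : NTM) (qr : ℕ) (ρ : Config) : Prop := ¬ RecurringFrom M qr ρ

end ChaseTermination
namespace ChaseTermination

/-! ### The rule set `Σ_M` of Section 4 and the databases `D_ρ` -/

/-- Predicate codes. `pF`, `pR` are the ternary time/tape successor predicates. -/
def pF : ℕ := 0
def pR : ℕ := 1
def pCL : ℕ := 2
def pCR : ℕ := 3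
def pReal : ℕ := 4
def pBrake : ℕ := 5
def pNextBr : ℕ := 6
def pEnd : ℕ := 7
/-- The binary letter predicate for the tape symbol `a`. -/
def pLetter (a : ℕ) : ℕ := 8 + 2 * a
/-- The binary state predicate for the state `q`. -/
def pState (q : ℕ) : ℕ := 9 + 2 * q

/-- Variable codes used in the rules: `x, y, x', y', w, w'` are `0, …, 5`. -/
def tv (v : ℕ) : RTerm := Sum.inl v

def A1 (p : ℕ) (s : RTerm) : Atom := (p, [s])
def A2 (p : ℕ) (s t : RTerm) : Atom := (p, [s, t])
def A3 (p : ℕ) (s t u : RTerm) : Atom := (p, [s, t, u])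

/-- `brSet(x, w)` as atoms: `{F(x,w,w), R(x,w,w), Real(x), Brake(w)}`. -/
def brSetA (x w : RTerm) : List Atom := [A3 pF x w w, A3 pR x w w, A1 pReal x, A1 pBrake w]

/-- Tape alphabet including the blank: `Γ ∪ {B}`. -/
def letters (M : NTM) : List ℕ := List.range (NTM.blank M + 1)
def states (M : NTM) : List ℕ := List.range (NTM.numStates M)

/-- The rule `R_Brake`. -/
def ruleBrake (M : NTM) : Rule :=
  ([A1 pBrake (tv 4)],
    ((letters M).map fun a => A2 (pLetter a) (tv 4) (tv 4)) ++
    ((states M).map fun q => A2 (pState q) (tv 4) (tv 4)) ++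
    [A3 pF (tv 4) (tv 4) (tv 4), A3 pR (tv 4) (tv 4) (tv 4),
     A2 pCL (tv 4) (tv 4), A2 pCR (tv 4) (tv 4), A1 pReal (tv 4), A2 pNextBr (tv 4) (tv 4)])

/-- The rule `R_nextBr`. -/
def ruleNextBr : Rule :=
  (brSetA (tv 0) (tv 4) ++ [A2 pNextBr (tv 4) (tv 5)], brSetA (tv 0) (tv 5))

/-- Transition rule for `(q', b, →) ∈ δ(q, a)` and the letter `c`; if `q = qr` a fresh
brake `w'` is created together with a `nextBr`-atom, otherwise the brake `w` is reused. -/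
def mkTransRight (qr q a q' b c : ℕ) : Rule :=
  ([A2 (pState q) (tv 0) (tv 4), A2 (pLetter a) (tv 0) (tv 4), A3 pR (tv 0) (tv 1) (tv 4),
    A2 (pLetter c) (tv 1) (tv 4)] ++ brSetA (tv 0) (tv 4) ++ brSetA (tv 1) (tv 4),
   if q = qr then
     [A2 (pState q') (tv 3) (tv 5), A2 (pLetter c) (tv 3) (tv 5), A2 (pLetter b) (tv 2) (tv 5),
      A3 pR (tv 2) (tv 3) (tv 5), A3 pF (tv 0) (tv 2) (tv 5), A3 pF (tv 1) (tv 3) (tv 5),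
      A2 pCL (tv 2) (tv 5), A2 pCR (tv 3) (tv 5)] ++
      brSetA (tv 2) (tv 5) ++ brSetA (tv 3) (tv 5) ++ [A2 pNextBr (tv 4) (tv 5)]
   else
     [A2 (pState q') (tv 3) (tv 4), A2 (pLetter c) (tv 3) (tv 4), A2 (pLetter b) (tv 2) (tv 4),
      A3 pR (tv 2) (tv 3) (tv 4), A3 pF (tv 0) (tv 2) (tv 4), A3 pF (tv 1) (tv 3) (tv 4),
      A2 pCL (tv 2) (tv 4), A2 pCR (tv 3) (tv 4)] ++ brSetA (tv 2) (tv 4) ++ brSetA (tv 3) (tv 4))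

/-- Transition rule for `(q', b, ←) ∈ δ(q, a)` and the letter `c`. -/
def mkTransLeft (qr q a q' b c : ℕ) : Rule :=
  ([A2 (pState q) (tv 0) (tv 4), A2 (pLetter a) (tv 0) (tv 4), A3 pR (tv 1) (tv 0) (tv 4),
    A2 (pLetter c) (tv 1) (tv 4)] ++ brSetA (tv 0) (tv 4) ++ brSetA (tv 1) (tv 4),
   if q = qr then
     [A2 (pState q') (tv 3) (tv 5), A2 (pLetter c) (tv 3) (tv 5), A2 (pLetter b) (tv 2) (tv 5),
      A3 pR (tv 3) (tv 2) (tv 5), A3 pF (tv 0) (tv 2) (tv 5), A3 pF (tv 1) (tv 3) (tv 5),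
      A2 pCL (tv 3) (tv 5), A2 pCR (tv 2) (tv 5)] ++
      brSetA (tv 2) (tv 5) ++ brSetA (tv 3) (tv 5) ++ [A2 pNextBr (tv 4) (tv 5)]
   else
     [A2 (pState q') (tv 3) (tv 4), A2 (pLetter c) (tv 3) (tv 4), A2 (pLetter b) (tv 2) (tv 4),
      A3 pR (tv 3) (tv 2) (tv 4), A3 pF (tv 0) (tv 2) (tv 4), A3 pF (tv 1) (tv 3) (tv 4),
      A2 pCL (tv 3) (tv 4), A2 pCR (tv 2) (tv 4)] ++ brSetA (tv 2) (tv 4) ++ brSetA (tv 3) (tv 4))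

/-- All transition rules of `Σ_M` (one per table entry and letter `c`). -/
def transRules (M : NTM) (qr : ℕ) : List Rule :=
  (NTM.table M).foldr (fun e acc =>
    ((letters M).map fun cc =>
      if e.2.2.2 = true then mkTransRight qr e.1.1 e.1.2 e.2.1 e.2.2.1 cc
      else mkTransLeft qr e.1.1 e.1.2 e.2.1 e.2.2.1 cc) ++ acc) []

/-- The rule `R_{C_R}` for the letter `a`. -/
def mkCopyRight (a : ℕ) : Rule :=
  ([A2 pCR (tv 2) (tv 5), A3 pF (tv 0) (tv 2) (tv 5), A3 pR (tv 0) (tv 1) (tv 4),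
    A2 (pLetter a) (tv 1) (tv 4)] ++
    brSetA (tv 0) (tv 4) ++ brSetA (tv 2) (tv 5) ++ brSetA (tv 1) (tv 4),
   [A3 pF (tv 1) (tv 3) (tv 5), A3 pR (tv 2) (tv 3) (tv 5), A2 (pLetter a) (tv 3) (tv 5),
    A2 pCR (tv 3) (tv 5)] ++ brSetA (tv 3) (tv 5))

/-- The rule `R_{C_L}` for the letter `a`. -/
def mkCopyLeft (a : ℕ) : Rule :=
  ([A2 pCL (tv 2) (tv 5), A3 pF (tv 0) (tv 2) (tv 5), A3 pR (tv 1) (tv 0) (tv 4),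
    A2 (pLetter a) (tv 1) (tv 4)] ++
    brSetA (tv 0) (tv 4) ++ brSetA (tv 2) (tv 5) ++ brSetA (tv 1) (tv 4),
   [A3 pF (tv 1) (tv 3) (tv 5), A3 pR (tv 3) (tv 2) (tv 5), A2 (pLetter a) (tv 3) (tv 5),
    A2 pCL (tv 3) (tv 5)] ++ brSetA (tv 3) (tv 5))

def copyRightRules (M : NTM) : List Rule := (letters M).map mkCopyRight
def copyLeftRules (M : NTM) : List Rule := (letters M).map mkCopyLeft

/-- The tape-extension rule `R_End`. -/
def ruleEnd (M : NTM) : Rule :=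
  ([A2 pCR (tv 2) (tv 5), A3 pF (tv 0) (tv 2) (tv 5), A2 pEnd (tv 0) (tv 4)] ++
    brSetA (tv 0) (tv 4) ++ brSetA (tv 2) (tv 5),
   [A3 pR (tv 2) (tv 3) (tv 5), A2 (pLetter (NTM.blank M)) (tv 3) (tv 5),
    A2 pEnd (tv 3) (tv 5)] ++ brSetA (tv 3) (tv 5))

/-- The rule set `Σ_M` of Section 4 (simulating `M`, with the designated state `qr`). -/
def SigmaM (M : NTM) (qr : ℕ) : RuleSet :=
  [ruleBrake M, ruleNextBr] ++ transRules M qr ++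
    copyLeftRules M ++ copyRightRules M ++ [ruleEnd M]

/-- The constant `c_i` (0-based). -/
def cst (i : ℕ) : GroundTerm := Sum.inl (i + 1)
/-- The brake constant `w₁` of the database. -/
def w1 : GroundTerm := Sum.inl 0

/-- `brSet(x, w)` as facts. -/
def brSetF (x w : GroundTerm) : List Fact :=
  [(pF, [x, w, w]), (pR, [x, w, w]), (pReal, [x]), (pBrake, [w])]

/-- The database `D_ρ` encoding a configuration `ρ`. -/
def Drho (M : NTM) (ρ : Config) : Database :=
  ((List.range ρ.1.length).map fun i => ((pR, [cst i, cst (i + 1), w1]) : Fact)) ++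
  ((List.range ρ.1.length).map fun i => ((pLetter (ρ.1.getD i 0), [cst i, w1]) : Fact)) ++
  [((pState ρ.2.2, [cst ρ.2.1, w1]) : Fact),
   ((pLetter (NTM.blank M), [cst ρ.1.length, w1]) : Fact),
   ((pEnd, [cst ρ.1.length, w1]) : Fact)] ++
  (List.range (ρ.1.length + 1)).foldr (fun i acc => brSetF (cst i) w1 ++ acc) []

/-! ### Wild frontiers -/

/-- The atoms explicitly required by the wild-frontier condition ("other" atoms are those
not in this set). -/
def wfListed (M : NTM) (ρ : Config) (w : GroundTerm) (x : ℕ → GroundTerm) : Set Fact :=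
  {f | (∃ i < ρ.1.length,
          f = ((pR, [x i, x (i + 1), w]) : Fact) ∨
          f = ((pLetter (ρ.1.getD i 0), [x i, w]) : Fact)) ∨
    f = ((pState ρ.2.2, [x ρ.2.1, w]) : Fact) ∨
    f = ((pEnd, [x ρ.1.length, w]) : Fact) ∨
    f = ((pLetter (NTM.blank M), [x ρ.1.length, w]) : Fact) ∨
    (∃ i ≤ ρ.1.length, f ∈ brSetF (x i) w)}

/-- `F` has a wild frontier of the configuration `ρ` overseen by `w` (Definition 4.4). -/
def WildFrontier (M : NTM) (F : Set Fact) (ρ : Config) (w : GroundTerm) : Prop :=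
  ∃ x : ℕ → GroundTerm,
    ((pReal, [w]) : Fact) ∉ F ∧
    (∀ i < ρ.1.length, ((pR, [x i, x (i + 1), w]) : Fact) ∈ F ∧
      ((pLetter (ρ.1.getD i 0), [x i, w]) : Fact) ∈ F) ∧
    ((pState ρ.2.2, [x ρ.2.1, w]) : Fact) ∈ F ∧
    ((pEnd, [x ρ.1.length, w]) : Fact) ∈ F ∧
    ((pLetter (NTM.blank M), [x ρ.1.length, w]) : Fact) ∈ F ∧
    (∀ i ≤ ρ.1.length, ∀ f ∈ brSetF (x i) w, f ∈ F) ∧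
    (∀ f ∈ F, f ∉ wfListed M ρ w x →
      ∀ i ≤ ρ.1.length, f.2.head? = some (x i) → f.2[1]? = some w)

/-! ### State atoms, generation, bow ties -/

/-- `g` is a brake of `F`. -/
def isBrake (F : Set Fact) (g : GroundTerm) : Prop := ((pBrake, [g]) : Fact) ∈ F

/-- A state atom of `F`: an atom `q(x, w)` with `q` a state of `M` and `x` not a brake. -/
def StateAtom (M : NTM) (F : Set Fact) (f : Fact) : Prop :=
  ∃ q : ℕ, q < NTM.numStates M ∧ ∃ x wb : GroundTerm,
    f = ((pState q, [x, wb]) : Fact) ∧ f ∈ F ∧ ¬ isBrake F x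

/-- `A` precedes `A'` in the derivation `c`: some applied trigger has `A` in its support
and `A'` in its output. -/
def precedes {S : RuleSet} {D : Set Fact} (c : Chase S D) (A A' : Fact) : Prop :=
  ∃ i : ℕ, (i : ℕ∞) < c.len ∧ A ∈ support (c.trig i) ∧ A' ∈ outputOf (c.trig i) (c.ext i)

/-- The fact `f` is generated (newly produced) at step `i` of the derivation `c`. -/
def generatedAt {S : RuleSet} {D : Set Fact} (c : Chase S D) (i : ℕ) (f : Fact) : Prop :=
  (i : ℕ∞) < c.len ∧ f ∈ outputOf (c.trig i) (c.ext i) ∧ f ∉ c.fact i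

/-- The fact `f` is generated by (an application of) one of the rules in `Rs`. -/
def generatedBy {S : RuleSet} {D : Set Fact} (c : Chase S D) (Rs : List Rule) (f : Fact) : Prop :=
  ∃ i : ℕ, generatedAt c i f ∧ (c.trig i).1 ∈ Rs

/-- Semantically meaningful terms: all terms of `F` except the brakes. -/
def semterms (F : Set Fact) : Set GroundTerm := {g | g ∈ termsOf F ∧ ¬ isBrake F g}

/-- The edge relation `E_R`: `(x, y) ∈ E_R` iff `R(x, y, w) ∈ F` for some `w`. -/
def ER (F : Set Fact) (u v : GroundTerm) : Prop := ∃ w, ((pR, [u, v, w]) : Fact) ∈ F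

/-- The weakly connected component of `x` in the graph induced by `E` on the vertex set `V`. -/
def wcc {α : Type} (V : Set α) (E : α → α → Prop) (x : α) : Set α :=
  {z | z ∈ V ∧ Relation.ReflTransGen (fun u v => u ∈ V ∧ v ∈ V ∧ (E u v ∨ E v u)) x z}

/-- Directed tree rooted in `r` on the vertex set `V` with edge relation `E`. -/
def IsDirTree {α : Type} (V : Set α) (E : α → α → Prop) (r : α) : Prop :=
  r ∈ V ∧
  (∀ v ∈ V, Relation.ReflTransGen (fun u v' => u ∈ V ∧ v' ∈ V ∧ E u v') r v) ∧
  (∀ v ∈ V, v ≠ r → ∃! u, u ∈ V ∧ E u v) ∧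
  (∀ u ∈ V, ¬ E u r)

/-- A bow tie with center `(x, y)` (Definition 6.2): `V_x^{-y}` induces a directed tree on the
inverse edges rooted in `x`, `V_y^{-x}` induces a directed tree rooted in `y`, and the two
components partition `V`. -/
def IsBowTie {α : Type} (V : Set α) (E : α → α → Prop) (x y : α) : Prop :=
  x ∈ V ∧ y ∈ V ∧ E x y ∧
  IsDirTree (wcc (V \ {y}) E x) (fun u v => E v u) x ∧
  IsDirTree (wcc (V \ {x}) E y) E y ∧
  wcc (V \ {y}) E x ∩ wcc (V \ {x}) E y = ∅ ∧
  wcc (V \ {y}) E x ∪ wcc (V \ {x}) E y = V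

/-- `bowtie(A)` for a state atom `q(x, w)`: the weakly connected component of `x` in
`(semterms F, E_R)`. -/
def bowtieOf (F : Set Fact) (x : GroundTerm) : Set GroundTerm := wcc (semterms F) (ER F) x

/-- A maximal `E`-path in the vertex set `V`. -/
def IsMaxPath {α : Type} (V : Set α) (E : α → α → Prop) (l : List α) : Prop :=
  l ≠ [] ∧ (∀ z ∈ l, z ∈ V) ∧ List.Chain' E l ∧
  (∀ z ∈ V, ∀ a, l.head? = some a → ¬ E z a) ∧
  (∀ z ∈ V, ∀ a, l.getLast? = some a → ¬ E a z)

/-- `configs(A)` (Definition 6.4): one candidate configuration per maximal path of `bowtie(A)`. -/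
def configsOf (M : NTM) (F : Set Fact) (A : Fact) : Set (Set Fact) :=
  {S | ∃ q : ℕ, ∃ x w : GroundTerm, A = ((pState q, [x, w]) : Fact) ∧
    ∃ l : List GroundTerm, IsMaxPath (bowtieOf F x) (ER F) l ∧
      S = insert A
        ({f | ∃ z ∈ l, f ∈ brSetF z w} ∪
         {f | f ∈ F ∧ (f.1 = pR ∨ f.1 = pEnd ∨ ∃ a ∈ letters M, f.1 = pLetter a) ∧
           f.2 ≠ [] ∧ f.2.getLast? = some w ∧ ∀ z ∈ f.2.dropLast, z ∈ l})}

/-- Homomorphic embedding of fact sets: a map on nulls (fixing all constants) sending `S`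
into `T`. -/
def mapG (h : ℕ → GroundTerm) : GroundTerm → GroundTerm
  | Sum.inl cc => Sum.inl cc
  | Sum.inr n => h n

def mapFact (h : ℕ → GroundTerm) (f : Fact) : Fact := (f.1, f.2.map (mapG h))

def HomEmbeds (S T : Set Fact) : Prop := ∃ h : ℕ → GroundTerm, ∀ f ∈ S, mapFact h f ∈ T

end ChaseTermination
namespace ChaseTermination

/-! ### The machine `M_Σ` (Definition 4.1), modelled by its canonical runs

A run of `M_Σ` on the encoding of a database corresponds exactly to a restricted chase
derivation of `⟨Σ, D⟩` (step 4 of the procedure) together with the counter `j`; the machine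
visits its designated state `q_r` once each time `j` is incremented (step 5), so a run visits
`q_r` infinitely often iff the derivation is infinite and `jseq` is unbounded. -/

open scoped Classical in
/-- The value of the counter `j` of `M_Σ` after `i` iterations of its main loop, when its
non-deterministic choices build the chase derivation `c`. -/
noncomputable def jseq {S : RuleSet} {D : Set Fact} (c : Chase S D) : ℕ → ℕ
  | 0 => 0
  | i + 1 =>
      if ∀ t : Trigger, Active S (c.fact (jseq c i)) t → obsolete t (c.fact i) then
        jseq c i + 1
      else jseq c i

/-! ### Oblivious and core chase variants -/

/-- A (possibly infinite) oblivious chase derivation: triggers need only be loaded, but no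
trigger (instance) is ever applied twice. -/
structure OblChase (S : RuleSet) (D : Set Fact) where
  len : ℕ∞
  fact : ℕ → Set Fact
  trig : ℕ → Trigger
  ext : ℕ → ℕ → GroundTerm
  init : fact 0 = D
  memAt : ∀ i : ℕ, (i : ℕ∞) < len → (trig i).1 ∈ S
  loadAt : ∀ i : ℕ, (i : ℕ∞) < len → loaded (trig i) (fact i)
  noRepeat : ∀ i j : ℕ, (i : ℕ∞) < len → (j : ℕ∞) < len →
    instOf (trig i) = instOf (trig j) → i = j
  extOk : ∀ i : ℕ, (i : ℕ∞) < len → properExt (trig i) (fact i) (ext i)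
  succ : ∀ i : ℕ, (i : ℕ∞) < len → fact (i + 1) = fact i ∪ outputOf (trig i) (ext i)
  stall : ∀ i : ℕ, ¬ ((i : ℕ∞) < len) → fact (i + 1) = fact i

/-- Fairness for the oblivious chase: every trigger that becomes loaded is eventually applied. -/
def OblFair {S : RuleSet} {D : Set Fact} (c : OblChase S D) : Prop :=
  ∀ t : Trigger, t.1 ∈ S → ∀ i : ℕ, loaded t (c.fact i) →
    ∃ j : ℕ, (j : ℕ∞) < c.len ∧ instOf (c.trig j) = instOf t

/-- `H` is a retract of `G`: `H ⊆ G` and some homomorphism (fixing constants) maps `G` into `H`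
leaving `H` pointwise fixed. -/
def RetractOf (G H : Set Fact) : Prop :=
  H ⊆ G ∧ ∃ h : ℕ → GroundTerm, (∀ f ∈ G, mapFact h f ∈ H) ∧ ∀ f ∈ H, mapFact h f = f

/-- `H` is a core of `G`: a retract of `G` without proper retracts. -/
def IsCoreOf (H G : Set Fact) : Prop := RetractOf G H ∧ ∀ H', RetractOf H H' → H' = H

/-- `G` is obtained from `F` by applying all active triggers in parallel, each with fresh
pairwise distinct nulls (distinct trigger instances use disjoint fresh nulls). -/
def IsParallelStep (S : RuleSet) (F G : Set Fact) : Prop :=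
  ∃ pe : Trigger → (ℕ → GroundTerm),
    (∀ t : Trigger, Active S F t → properExt t F (pe t)) ∧
    (∀ t t' : Trigger, Active S F t → Active S F t' → instOf t = instOf t' →
      outputOf t (pe t) = outputOf t' (pe t')) ∧
    (∀ t t' : Trigger, Active S F t → Active S F t' → instOf t ≠ instOf t' →
      ∀ n : ℕ, (Sum.inr n : GroundTerm) ∉ termsOf F →
        (Sum.inr n : GroundTerm) ∈ termsOf (outputOf t (pe t)) →
        (Sum.inr n : GroundTerm) ∉ termsOf (outputOf t' (pe t'))) ∧
    G = F ∪ ⋃ t ∈ {t : Trigger | Active S F t}, outputOf t (pe t)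

/-- A (possibly infinite) core chase sequence: `F_{i+1}` is a core of the parallel application
of all active triggers to `F_i`, and the sequence stops exactly when this is a fixpoint. -/
structure CoreChase (S : RuleSet) (D : Set Fact) where
  len : ℕ∞
  fact : ℕ → Set Fact
  init : fact 0 = D
  step : ∀ i : ℕ, (i : ℕ∞) < len →
    ∃ G, IsParallelStep S (fact i) G ∧ IsCoreOf (fact (i + 1)) G ∧ fact (i + 1) ≠ fact i
  halt : ∀ i : ℕ, ¬ ((i : ℕ∞) < len) → ∃ G, IsParallelStep S (fact i) G ∧ IsCoreOf (fact i) G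
  stall : ∀ i : ℕ, ¬ ((i : ℕ∞) < len) → fact (i + 1) = fact i

/-- The three chase variants. -/
inductive Variant : Type | obl | rest | core

/-- `qExists` ("sometimes") and `qForall` ("always") termination. -/
inductive Quant : Type | qExists | qForall

/-- `Terminates v q S D`: the knowledge base `⟨S, D⟩` `q`-terminates for the chase variant `v`
(`qExists`: some chase sequence is finite; `qForall`: all chase sequences are finite). -/
def Terminates (v : Variant) (q : Quant) (S : RuleSet) (D : Set Fact) : Prop :=
  match v, q with
  | .rest, .qExists => ∃ c : Chase S D, Fair c ∧ c.len ≠ ⊤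
  | .rest, .qForall => ∀ c : Chase S D, Fair c → c.len ≠ ⊤
  | .obl, .qExists => ∃ c : OblChase S D, OblFair c ∧ c.len ≠ ⊤
  | .obl, .qForall => ∀ c : OblChase S D, OblFair c → c.len ≠ ⊤
  | .core, .qExists => ∃ c : CoreChase S D, c.len ≠ ⊤
  | .core, .qForall => ∀ c : CoreChase S D, c.len ≠ ⊤

end ChaseTermination

namespace ChaseTermination

open Nat.Partrec (Code)

/-! ### Predicate symbols -/

/-- Predicate symbols of the rule sets used in the reduction. Every symbol except `brake` takes the
brake overseeing the fact as its first argument. The symbols up to `ev` speak about natural numbers,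
`ev c` being the graph of the partial recursive function with code `c`. -/
inductive PSym : Type
  | num | zero | suc | add | mul | pr | input | ver | st | cand
  | ev (c : Code)
  | brake | child | pick | grow | copy

namespace PSym

/-- The natural number naming a predicate symbol. -/
def code : PSym → ℕ
  | num => 0
  | zero => 1
  | suc => 2
  | add => 3
  | mul => 4
  | pr => 5
  | input => 6
  | ver => 7
  | st => 8
  | cand => 9
  | brake => 10
  | child => 11
  | pick => 12
  | grow => 13
  | copy => 14
  | ev c => 15 + Encodable.encode c

theorem code_injective : Function.Injective code := by
  intro s t h
  cases s <;> cases t <;> simp_all [code] <;> omega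

/-- The symbols that speak about natural numbers. -/
def Arith : PSym → Prop
  | brake | child | pick | grow | copy => False
  | _ => True

/-- The arithmetical symbols that are derived by arithmetical rules only. -/
def Derived : PSym → Prop
  | add | mul | pr | input | ver | cand | ev _ => True
  | _ => False

end PSym

/-- The fact with predicate symbol `s`. -/
def fct (s : PSym) (l : List GroundTerm) : Fact := (s.code, l)

/-- The atom with predicate symbol `s` and variables `l`. -/
def atm (s : PSym) (l : List ℕ) : Atom := (s.code, l.map Sum.inl)

@[simp]
theorem fct_inj {s t : PSym} {l m : List GroundTerm} : fct s l = fct t m ↔ s = t ∧ l = m := by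
  simp [fct, PSym.code_injective.eq_iff]

@[simp]
theorem applyA_atm (σ : ℕ → GroundTerm) (s : PSym) (l : List ℕ) :
    applyA σ (atm s l) = fct s (l.map σ) := by
  simp [applyA, atm, fct, Function.comp_def, applyT]

@[simp]
theorem atomHasVar_atm (s : PSym) (l : List ℕ) (v : ℕ) : atomHasVar (atm s l) v ↔ v ∈ l := by
  simp [atomHasVar, atm]

theorem atomNullFree_atm (s : PSym) (l : List ℕ) : atomNullFree (atm s l) := by
  simp [atomNullFree, atm]

/-! ### Arithmetical rules -/

/-- A Datalog rule over the arithmetical symbols, without the brake argument. -/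
abbrev ArithRule : Type := List (PSym × List ℕ) × (PSym × List ℕ)

/-- The rule obtained by adding the brake, which is variable `0`, to all atoms. -/
def ArithRule.toRule (r : ArithRule) : Rule :=
  (r.1.map fun b => atm b.1 (0 :: b.2.map (· + 1)), [atm r.2.1 (0 :: r.2.2.map (· + 1))])

/-- Well-formedness: only arithmetical symbols, a derived symbol in the head, all variables of the
head occur in the body, and the body is non-empty. -/
def ArithRule.WF (r : ArithRule) : Prop :=
  r.2.1.Derived ∧ (∀ b ∈ r.1, b.1.Arith) ∧ (∀ x ∈ r.2.2, ∃ b ∈ r.1, x ∈ b.2) ∧ r.1 ≠ []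

open PSym in
/-- Rules defining addition, multiplication and the pairing function. -/
def pairingRules : List ArithRule :=
  [([(num, [0]), (zero, [1])], (add, [0, 1, 0])),
   ([(add, [0, 1, 2]), (suc, [1, 3]), (suc, [2, 4])], (add, [0, 3, 4])),
   ([(num, [0]), (zero, [1])], (mul, [0, 1, 1])),
   ([(mul, [0, 1, 2]), (suc, [1, 3]), (add, [2, 0, 4])], (mul, [0, 3, 4])),
   ([(suc, [5, 6]), (add, [0, 6, 1]), (mul, [1, 1, 2]), (add, [2, 0, 3])], (pr, [0, 1, 3])),
   ([(add, [1, 6, 0]), (mul, [0, 0, 2]), (add, [2, 0, 3]), (add, [3, 1, 4])], (pr, [0, 1, 4]))]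

open PSym in
/-- Rules evaluating a code and its subcodes. -/
def codeRules : Code → List ArithRule
  | .zero => [([(num, [0]), (zero, [1])], (ev .zero, [0, 1]))]
  | .succ => [([(suc, [0, 1])], (ev .succ, [0, 1]))]
  | .left => [([(pr, [0, 1, 2])], (ev .left, [2, 0]))]
  | .right => [([(pr, [0, 1, 2])], (ev .right, [2, 1]))]
  | .pair f g =>
      ([(ev f, [0, 1]), (ev g, [0, 2]), (pr, [1, 2, 3])], (ev (.pair f g), [0, 3])) ::
        (codeRules f ++ codeRules g)
  | .comp f g =>
      ([(ev g, [0, 1]), (ev f, [1, 2])], (ev (.comp f g), [0, 2])) ::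
        (codeRules f ++ codeRules g)
  | .prec f g =>
      ([(zero, [1]), (pr, [0, 1, 2]), (ev f, [0, 3])], (ev (.prec f g), [2, 3])) ::
      ([(pr, [0, 1, 2]), (ev (.prec f g), [2, 3]), (suc, [1, 4]), (pr, [0, 4, 5]),
        (pr, [1, 3, 6]), (pr, [0, 6, 7]), (ev g, [7, 8])], (ev (.prec f g), [5, 8])) ::
        (codeRules f ++ codeRules g)
  | .rfind' f =>
      ([(pr, [0, 1, 2]), (ev f, [2, 3]), (zero, [3])], (ev (.rfind' f), [2, 1])) ::
      ([(pr, [0, 1, 2]), (ev f, [2, 3]), (suc, [4, 3]), (suc, [1, 5]), (pr, [0, 5, 6]),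
        (ev (.rfind' f), [6, 7])], (ev (.rfind' f), [2, 7])) ::
        codeRules f

open PSym in
/-- Rules for verified lists and for the candidate lists extending the state. -/
def verRules (c : Code) : List ArithRule :=
  [([(zero, [0]), (input, [1]), (pr, [1, 0, 2]), (ev c, [2, 0])], (ver, [0])),
   ([(ver, [0]), (pr, [1, 0, 2]), (suc, [2, 3]), (input, [4]), (pr, [4, 3, 5]), (ev c, [5, 6]),
     (zero, [6])], (ver, [3])),
   ([(st, [0]), (pr, [1, 0, 2]), (suc, [2, 3]), (ver, [3])], (cand, [3]))]

open PSym in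
/-- The rule recognizing the number `a`. -/
def inputRule (a : ℕ) : ArithRule :=
  ((zero, [0]) :: (List.range a).map (fun i => (suc, [i, i + 1])), (input, [a]))

/-- All arithmetical rules. -/
def arithRules (c : Code) (a : ℕ) : List ArithRule :=
  inputRule a :: (pairingRules ++ verRules c ++ codeRules c)

theorem inputRule_wf (a : ℕ) : (inputRule a).WF := by
  refine ⟨trivial, ?_, ?_, by simp [inputRule]⟩
  · simp only [inputRule, List.mem_cons, List.mem_map]
    rintro b (rfl | ⟨i, -, rfl⟩) <;> trivial
  · intro x hx
    obtain rfl : x = a := by simpa [inputRule] using hx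
    cases x with
    | zero => exact ⟨(.zero, [0]), by simp [inputRule], by simp⟩
    | succ n => exact ⟨(.suc, [n, n + 1]), by simp [inputRule], by simp⟩

theorem codeRules_wf (c : Code) : ∀ r ∈ codeRules c, r.WF := by
  induction c <;> simp only [codeRules, List.forall_mem_cons, List.forall_mem_append] <;>
    and_intros <;> first
      | assumption
      | simp [ArithRule.WF, PSym.Derived, PSym.Arith]

theorem pairingRules_wf : ∀ r ∈ pairingRules, r.WF := by
  simp only [pairingRules, List.forall_mem_cons]
  and_intros <;> simp [ArithRule.WF, PSym.Derived, PSym.Arith]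

theorem verRules_wf (c : Code) : ∀ r ∈ verRules c, r.WF := by
  simp only [verRules, List.forall_mem_cons]
  and_intros <;> simp [ArithRule.WF, PSym.Derived, PSym.Arith]

theorem arithRules_wf (c : Code) (a : ℕ) : ∀ r ∈ arithRules c a, r.WF := by
  intro r hr
  simp only [arithRules, List.mem_cons, List.mem_append] at hr
  rcases hr with rfl | (hr | hr) | hr
  · exact inputRule_wf a
  · exact pairingRules_wf r hr
  · exact verRules_wf c r hr
  · exact codeRules_wf c r hr

/-! ### Soundness of the arithmetical rules -/

/-- The intended interpretation of the arithmetical symbols, where `V` is the set of verified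
lists, `a` the input and `σ` the set of states. -/
def Interp (V : List ℕ → Prop) (a : ℕ) (σ : Set ℕ) : PSym → List ℕ → Prop
  | .num, l => ∃ n, l = [n]
  | .zero, l => l = [0]
  | .suc, l => ∃ n, l = [n, n + 1]
  | .add, l => ∃ m n, l = [m, n, m + n]
  | .mul, l => ∃ m n, l = [m, n, m * n]
  | .pr, l => ∃ m n, l = [m, n, Nat.pair m n]
  | .input, l => l = [a]
  | .ver, l => ∃ k : List ℕ, l = [Encodable.encode k] ∧ V k
  | .st, l => ∃ n ∈ σ, l = [n]
  | .cand, l => ∃ n, ∃ k : List ℕ,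
      l = [Encodable.encode (n :: k)] ∧ V (n :: k) ∧ Encodable.encode k ∈ σ
  | .ev c, l => ∃ n m, l = [n, m] ∧ m ∈ c.eval n
  | _, _ => False

/-- Validity of an arithmetical rule in the intended interpretation. -/
def ArithRule.Valid (V : List ℕ → Prop) (a : ℕ) (σ : Set ℕ) (r : ArithRule) : Prop :=
  ∀ v : ℕ → ℕ, (∀ b ∈ r.1, Interp V a σ b.1 (b.2.map v)) → Interp V a σ r.2.1 (r.2.2.map v)

theorem inputRule_valid (V : List ℕ → Prop) (a : ℕ) (σ : Set ℕ) : (inputRule a).Valid V a σ := by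
  intro v h
  have h0 : v 0 = 0 := by simpa [inputRule, Interp] using h (.zero, [0]) (by simp [inputRule])
  have hs : ∀ i < a, v (i + 1) = v i + 1 := by
    intro i hi
    have := h (.suc, [i, i + 1]) (by simp [inputRule, hi])
    simpa [Interp] using this
  have : ∀ i ≤ a, v i = i := by
    intro i hi
    induction i with
    | zero => exact h0
    | succ i ih => rw [hs i hi, ih (by omega)]
  simpa [inputRule, Interp] using this a le_rfl

theorem pairingRules_valid (V : List ℕ → Prop) (a : ℕ) (σ : Set ℕ) :
    ∀ r ∈ pairingRules, r.Valid V a σ := by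
  simp only [pairingRules, List.forall_mem_cons, ArithRule.Valid, Interp, List.map_cons,
    List.map_nil, List.cons.injEq, and_true, List.not_mem_nil, false_imp_iff, implies_true]
  refine ⟨?_, ?_, ?_, ?_, ?_, ?_⟩
  · rintro v ⟨-, h⟩
    exact ⟨_, _, rfl, rfl, by simp [h]⟩
  · rintro v ⟨⟨m, n, h1, h2, h3⟩, ⟨i, h4, h5⟩, ⟨j, h6, h7⟩⟩
    exact ⟨_, _, rfl, rfl, by omega⟩
  · rintro v ⟨-, h⟩
    exact ⟨_, _, rfl, rfl, by simp [h]⟩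
  · rintro v ⟨⟨m, n, h1, h2, h3⟩, ⟨i, h4, h5⟩, ⟨k, l, h6, h7, h8⟩⟩
    refine ⟨_, _, rfl, rfl, ?_⟩
    rw [h8, h5, ← h4, ← h6, ← h7, h3, h1, h2, mul_add, mul_one]
  · rintro v ⟨⟨i, h1, h2⟩, ⟨m, n, h3, h4, h5⟩, ⟨k, l, h6, h7, h8⟩, ⟨o, p, h9, h10, h11⟩⟩
    refine ⟨_, _, rfl, rfl, ?_⟩
    rw [Nat.pair, if_pos (by omega), h11, ← h9, ← h10, h8, ← h6, ← h7]
  · rintro v ⟨⟨m, n, h3, h4, h5⟩, ⟨k, l, h6, h7, h8⟩, ⟨o, p, h9, h10, h11⟩, ⟨s, t, h12, h13, h14⟩⟩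
    refine ⟨_, _, rfl, rfl, ?_⟩
    rw [Nat.pair, if_neg (by omega), h14, ← h12, ← h13, h11, ← h9, ← h10, h8, ← h6, ← h7]

theorem mem_eval_rfind' {f : Code} {a m r : ℕ} :
    r ∈ (Code.rfind' f).eval (Nat.pair a m) ↔
      ∃ k, r = k + m ∧ 0 ∈ f.eval (Nat.pair a (k + m)) ∧
        ∀ j < k, ∃ x, x + 1 ∈ f.eval (Nat.pair a (j + m)) := by
  simp only [Code.eval, Nat.unpaired, Nat.unpair_pair, Part.mem_map_iff]
  constructor
  · rintro ⟨k, h, rfl⟩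
    obtain ⟨h1, h2⟩ := Nat.mem_rfind.1 h
    refine ⟨k, rfl, by simpa using h1, fun j hj => ?_⟩
    have := h2 hj
    simp only [Part.map_eq_map, Part.mem_map_iff, decide_eq_false_iff_not] at this
    obtain ⟨x, hx, hx0⟩ := this
    obtain ⟨y, rfl⟩ := Nat.exists_eq_succ_of_ne_zero hx0
    exact ⟨y, hx⟩
  · rintro ⟨k, rfl, h1, h2⟩
    refine ⟨k, Nat.mem_rfind.2 ⟨by simpa using h1, fun {j} hj => ?_⟩, rfl⟩
    obtain ⟨x, hx⟩ := h2 j hj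
    simp only [Part.map_eq_map, Part.mem_map_iff, decide_eq_false_iff_not]
    exact ⟨x + 1, hx, by simp⟩

theorem mem_eval_prec_succ {f g : Code} {a k r : ℕ} :
    r ∈ (Code.prec f g).eval (Nat.pair a (k + 1)) ↔
      ∃ i ∈ (Code.prec f g).eval (Nat.pair a k), r ∈ g.eval (Nat.pair a (Nat.pair k i)) := by
  rw [Code.eval_prec_succ]
  simp

theorem codeRules_valid (V : List ℕ → Prop) (a : ℕ) (σ : Set ℕ) (c : Code) :
    ∀ r ∈ codeRules c, r.Valid V a σ := by
  induction c with
  | zero =>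
    simp only [codeRules, List.forall_mem_cons, ArithRule.Valid, Interp, List.map_cons,
      List.map_nil, List.cons.injEq, and_true, List.not_mem_nil, false_imp_iff, implies_true]
    rintro v ⟨-, h⟩
    exact ⟨_, _, ⟨rfl, rfl⟩, by simp [Code.eval, h, pure, PFun.pure]⟩
  | succ =>
    simp only [codeRules, List.forall_mem_cons, ArithRule.Valid, Interp, List.map_cons,
      List.map_nil, List.cons.injEq, and_true, List.not_mem_nil, false_imp_iff, implies_true]
    rintro v ⟨n, h, h'⟩
    exact ⟨_, _, ⟨rfl, rfl⟩, by simp [Code.eval, h, h']⟩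
  | left =>
    simp only [codeRules, List.forall_mem_cons, ArithRule.Valid, Interp, List.map_cons,
      List.map_nil, List.cons.injEq, and_true, List.not_mem_nil, false_imp_iff, implies_true]
    rintro v ⟨m, n, h, h', h''⟩
    exact ⟨_, _, ⟨rfl, rfl⟩, by simp [Code.eval, h, h'']⟩
  | right =>
    simp only [codeRules, List.forall_mem_cons, ArithRule.Valid, Interp, List.map_cons,
      List.map_nil, List.cons.injEq, and_true, List.not_mem_nil, false_imp_iff, implies_true]
    rintro v ⟨m, n, h, h', h''⟩
    exact ⟨_, _, ⟨rfl, rfl⟩, by simp [Code.eval, h', h'']⟩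
  | pair f g hf hg =>
    simp only [codeRules, List.forall_mem_cons, List.forall_mem_append]
    refine ⟨?_, hf, hg⟩
    simp only [List.forall_mem_cons, ArithRule.Valid, Interp, List.map_cons,
      List.map_nil, List.cons.injEq, and_true, List.not_mem_nil, false_imp_iff, implies_true]
    rintro v ⟨⟨m, n, ⟨rfl, rfl⟩, h1⟩, ⟨m, n, ⟨h0, rfl⟩, h2⟩, m, n, h3, h4, h5⟩
    refine ⟨_, _, ⟨rfl, rfl⟩, ?_⟩
    simp only [Code.eval, Seq.seq, Part.map_eq_map, Part.bind_map, Part.mem_bind_iff,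
      Part.mem_map_iff]
    exact ⟨_, h1, _, h0 ▸ h2, by rw [h5, h3, h4]⟩
  | comp f g hf hg =>
    simp only [codeRules, List.forall_mem_cons, List.forall_mem_append]
    refine ⟨?_, hf, hg⟩
    simp only [List.forall_mem_cons, ArithRule.Valid, Interp, List.map_cons,
      List.map_nil, List.cons.injEq, and_true, List.not_mem_nil, false_imp_iff, implies_true]
    rintro v ⟨⟨m, n, ⟨rfl, rfl⟩, h1⟩, ⟨m, n, ⟨h0, rfl⟩, h2⟩⟩
    refine ⟨_, _, ⟨rfl, rfl⟩, ?_⟩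
    exact Part.mem_bind_iff.2 ⟨_, h1, h0 ▸ h2⟩
  | prec f g hf hg =>
    simp only [codeRules, List.forall_mem_cons, List.forall_mem_append]
    refine ⟨?_, ?_, hf, hg⟩
    · simp only [List.forall_mem_cons, ArithRule.Valid, Interp, List.map_cons,
        List.map_nil, List.cons.injEq, and_true, List.not_mem_nil, false_imp_iff, implies_true]
      rintro v ⟨h0, ⟨m, n, h1, h2, h3⟩, ⟨m', n', ⟨h4, h5⟩, h6⟩⟩
      refine ⟨_, _, ⟨rfl, rfl⟩, ?_⟩
      rw [h3, ← h1, ← h2, h0, Code.eval_prec_zero, h4, h5]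
      exact h6
    · simp only [List.forall_mem_cons, ArithRule.Valid, Interp, List.map_cons,
        List.map_nil, List.cons.injEq, and_true, List.not_mem_nil, false_imp_iff, implies_true]
      rintro v ⟨⟨_, _, rfl, rfl, h1⟩, ⟨_, _, ⟨rfl, rfl⟩, h2⟩, ⟨_, rfl, h3⟩, ⟨_, _, rfl, rfl, h4⟩,
        ⟨_, _, rfl, rfl, h5⟩, ⟨_, _, rfl, rfl, h6⟩, ⟨_, _, ⟨rfl, rfl⟩, h7⟩⟩
      refine ⟨_, _, ⟨rfl, rfl⟩, ?_⟩
      rw [h4, h3, mem_eval_prec_succ]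
      exact ⟨v 3, h1 ▸ h2, by rwa [← h5, ← h6]⟩
  | rfind' f hf =>
    simp only [codeRules, List.forall_mem_cons]
    refine ⟨?_, ?_, hf⟩
    · simp only [List.forall_mem_cons, ArithRule.Valid, Interp, List.map_cons,
        List.map_nil, List.cons.injEq, and_true, List.not_mem_nil, false_imp_iff, implies_true]
      rintro v ⟨⟨_, _, rfl, rfl, h1⟩, ⟨_, _, ⟨rfl, rfl⟩, h2⟩, h3⟩
      refine ⟨_, _, ⟨rfl, rfl⟩, ?_⟩
      rw [h1, mem_eval_rfind']
      exact ⟨0, by simp, by rwa [zero_add, ← h1, ← h3], by simp⟩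
    · simp only [List.forall_mem_cons, ArithRule.Valid, Interp, List.map_cons,
        List.map_nil, List.cons.injEq, and_true, List.not_mem_nil, false_imp_iff, implies_true]
      rintro v ⟨⟨_, _, rfl, rfl, h1⟩, ⟨_, _, ⟨rfl, rfl⟩, h2⟩, ⟨_, rfl, h3⟩, ⟨_, rfl, h4⟩,
        ⟨_, _, rfl, rfl, h5⟩, ⟨_, _, ⟨rfl, rfl⟩, h6⟩⟩
      refine ⟨_, _, ⟨rfl, rfl⟩, ?_⟩
      rw [h5, h4, mem_eval_rfind'] at h6
      obtain ⟨k, hk, hk0, hk1⟩ := h6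
      rw [h1, mem_eval_rfind']
      refine ⟨k + 1, by omega, by rwa [add_assoc, add_comm 1], fun j hj => ?_⟩
      cases j with
      | zero => exact ⟨v 4, by rwa [zero_add, ← h1, ← h3]⟩
      | succ j =>
        obtain ⟨x, hx⟩ := hk1 j (by omega)
        exact ⟨x, by rwa [add_assoc, add_comm 1]⟩

/-- `k` is a reversed list all of whose prefixes are rejected by `R a`. -/
def Rejected (R : ℕ → List ℕ → Bool) (a : ℕ) (k : List ℕ) : Prop :=
  ∀ s, s <:+ k → R a s.reverse = false

theorem rejected_nil {R : ℕ → List ℕ → Bool} {a : ℕ} : Rejected R a [] ↔ R a [] = false := by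
  simp [Rejected]

theorem rejected_cons {R : ℕ → List ℕ → Bool} {a n : ℕ} {k : List ℕ} :
    Rejected R a (n :: k) ↔ R a (n :: k).reverse = false ∧ Rejected R a k := by
  simp [Rejected, List.suffix_cons_iff, or_imp, forall_and]

/-- The code `c` computes `R` on pairs of an input and a reversed list. -/
def Decides (c : Code) (R : ℕ → List ℕ → Bool) : Prop :=
  ∀ a, ∀ k : List ℕ, c.eval (Nat.pair a (Encodable.encode k)) =
    Part.some (Encodable.encode (R a k.reverse))

theorem exists_decides {R : ℕ → List ℕ → Bool} (hR : Computable₂ R) : ∃ c, Decides c R := by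
  have h : Computable fun p : ℕ × List ℕ => R p.1 p.2.reverse :=
    hR.comp Computable.fst (Computable.list_reverse.comp Computable.snd)
  have h' : Nat.Partrec _ := h
  obtain ⟨c, hc⟩ := Code.exists_code.1 h'
  refine ⟨c, fun a k => ?_⟩
  rw [hc]
  simp only [PFun.coe_val]
  have : Nat.pair a (Encodable.encode k) = Encodable.encode (a, k) := by simp
  rw [this, Encodable.encodek]
  simp

theorem Decides.mem {c : Code} {R : ℕ → List ℕ → Bool} (h : Decides c R) {a : ℕ} {k : List ℕ} :
    0 ∈ c.eval (Nat.pair a (Encodable.encode k)) ↔ R a k.reverse = false := by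
  rw [h a k]
  cases R a k.reverse <;> simp

theorem verRules_valid {c : Code} {R : ℕ → List ℕ → Bool} (h : Decides c R) (a : ℕ) (σ : Set ℕ) :
    ∀ r ∈ verRules c, r.Valid (Rejected R a) a σ := by
  simp only [verRules, List.forall_mem_cons, ArithRule.Valid, Interp, List.map_cons,
    List.map_nil, List.cons.injEq, and_true, List.not_mem_nil, false_imp_iff, implies_true]
  refine ⟨?_, ?_, ?_⟩
  · rintro v ⟨h0, h1, ⟨_, _, rfl, rfl, h2⟩, ⟨_, _, ⟨rfl, rfl⟩, h3⟩⟩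
    refine ⟨[], by simp [h0], ?_⟩
    rw [rejected_nil]
    rw [h0, h2, h1, h0] at h3
    exact (h.mem (k := [])).1 h3
  · rintro v ⟨⟨k, hk, hV⟩, ⟨_, _, rfl, rfl, h1⟩, ⟨_, rfl, h2⟩, h3, ⟨_, _, rfl, rfl, h4⟩,
      ⟨_, _, ⟨rfl, rfl⟩, h5⟩, h6⟩
    have e : v 3 = Encodable.encode (v 1 :: k) := by simp [h2, h1, hk]
    refine ⟨v 1 :: k, e, ?_⟩
    rw [rejected_cons]
    refine ⟨?_, hV⟩
    rw [h4, h3, h6, e] at h5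
    exact h.mem.1 h5
  · rintro v ⟨⟨n, hn, h0⟩, ⟨_, _, rfl, rfl, h1⟩, ⟨_, rfl, h2⟩, ⟨k, hk, hV⟩⟩
    rw [hk] at h2
    cases k with
    | nil => simp at h2
    | cons m k =>
      refine ⟨m, k, hk, hV, ?_⟩
      rw [Encodable.encode_list_cons, h1, Nat.succ_eq_add_one, add_left_inj, Nat.pair_eq_pair] at h2
      rw [h2.2, h0]
      exact hn

theorem arithRules_valid {c : Code} {R : ℕ → List ℕ → Bool} (h : Decides c R) (a : ℕ) (σ : Set ℕ) :
    ∀ r ∈ arithRules c a, r.Valid (Rejected R a) a σ := by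
  intro r hr
  simp only [arithRules, List.mem_cons, List.mem_append] at hr
  rcases hr with rfl | (hr | hr) | hr
  · exact inputRule_valid _ a σ
  · exact pairingRules_valid _ a σ r hr
  · exact verRules_valid h a σ r hr
  · exact codeRules_valid _ a σ c r hr

/-! ### Completeness of the arithmetical rules -/

/-- Arithmetical facts derivable when the only state is `e`. -/
inductive Der (P : List ArithRule) (e : ℕ) : PSym → List ℕ → Prop
  | num (n : ℕ) : Der P e .num [n]
  | zero : Der P e .zero [0]
  | suc (n : ℕ) : Der P e .suc [n, n + 1]
  | st : Der P e .st [e]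
  | rule (r : ArithRule) (hr : r ∈ P) (v : ℕ → ℕ) (h : ∀ b ∈ r.1, Der P e b.1 (b.2.map v)) :
      Der P e r.2.1 (r.2.2.map v)

namespace Der

variable {P : List ArithRule} {e : ℕ}

theorem of_rule {r : ArithRule} (hr : r ∈ P) (l : List ℕ)
    (h : ∀ b ∈ r.1, Der P e b.1 (b.2.map fun i => l.getD i 0)) :
    Der P e r.2.1 (r.2.2.map fun i => l.getD i 0) :=
  rule r hr _ h

theorem add (hP : pairingRules ⊆ P) (m n : ℕ) : Der P e .add [m, n, m + n] := by
  induction n with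
  | zero =>
    exact of_rule
      (hP (by simp [pairingRules]) : ([(.num, [0]), (.zero, [1])], (.add, [0, 1, 0])) ∈ P)
      [m, 0] (by simp [num, zero])
  | succ n ih =>
    exact of_rule (hP (by simp [pairingRules]) :
      ([(.add, [0, 1, 2]), (.suc, [1, 3]), (.suc, [2, 4])], (.add, [0, 3, 4])) ∈ P)
      [m, n, m + n, n + 1, m + n + 1] (by simp [ih, suc])

theorem mul (hP : pairingRules ⊆ P) (m n : ℕ) : Der P e .mul [m, n, m * n] := by
  induction n with
  | zero =>
    exact of_rule
      (hP (by simp [pairingRules]) : ([(.num, [0]), (.zero, [1])], (.mul, [0, 1, 1])) ∈ P)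
      [m, 0] (by simp [num, zero])
  | succ n ih =>
    exact of_rule (hP (by simp [pairingRules]) :
      ([(.mul, [0, 1, 2]), (.suc, [1, 3]), (.add, [2, 0, 4])], (.mul, [0, 3, 4])) ∈ P)
      [m, n, m * n, n + 1, m * n + m] (by simp [ih, suc, add hP])

theorem pr (hP : pairingRules ⊆ P) (m n : ℕ) : Der P e .pr [m, n, Nat.pair m n] := by
  unfold Nat.pair
  split_ifs with h
  · obtain ⟨d, rfl⟩ := Nat.exists_eq_add_of_lt h
    have h' : Der P e .add [m, d + 1, m + d + 1] := add hP m (d + 1)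
    exact of_rule (hP (by simp [pairingRules]) :
      ([(.suc, [5, 6]), (.add, [0, 6, 1]), (.mul, [1, 1, 2]), (.add, [2, 0, 3])],
        (.pr, [0, 1, 3])) ∈ P)
      [m, m + d + 1, (m + d + 1) * (m + d + 1), (m + d + 1) * (m + d + 1) + m, 0, d, d + 1]
      (by simp [suc, mul hP, add hP, h'])
  · obtain ⟨d, rfl⟩ := Nat.exists_eq_add_of_le (not_lt.1 h)
    exact of_rule (hP (by simp [pairingRules]) :
      ([(.add, [1, 6, 0]), (.mul, [0, 0, 2]), (.add, [2, 0, 3]), (.add, [3, 1, 4])],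
        (.pr, [0, 1, 4])) ∈ P)
      [n + d, n, (n + d) * (n + d), (n + d) * (n + d) + (n + d),
        (n + d) * (n + d) + (n + d) + n, 0, d]
      (by simp [mul hP, add hP])

theorem ev (hP : pairingRules ⊆ P) (c : Code) (hc : codeRules c ⊆ P) {n m : ℕ}
    (h : m ∈ c.eval n) : Der P e (.ev c) [n, m] := by
  induction c generalizing n m with
  | zero =>
    obtain rfl : m = 0 := by simpa [Code.eval, pure, PFun.pure] using h
    exact of_rule (hc (by simp [codeRules]) :
      ([(.num, [0]), (.zero, [1])], (.ev .zero, [0, 1])) ∈ P) [n, 0] (by simp [num, zero])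
  | succ =>
    obtain rfl : m = n + 1 := by simpa [Code.eval] using h
    exact of_rule (hc (by simp [codeRules]) :
      ([(.suc, [0, 1])], (.ev .succ, [0, 1])) ∈ P) [n, n + 1] (by simp [suc])
  | left =>
    obtain rfl : m = n.unpair.1 := by simpa [Code.eval] using h
    exact of_rule (hc (by simp [codeRules]) :
      ([(.pr, [0, 1, 2])], (.ev .left, [2, 0])) ∈ P) [n.unpair.1, n.unpair.2, n]
      (by simpa using pr hP n.unpair.1 n.unpair.2)
  | right =>
    obtain rfl : m = n.unpair.2 := by simpa [Code.eval] using h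
    exact of_rule (hc (by simp [codeRules]) :
      ([(.pr, [0, 1, 2])], (.ev .right, [2, 1])) ∈ P) [n.unpair.1, n.unpair.2, n]
      (by simpa using pr hP n.unpair.1 n.unpair.2)
  | pair f g hf hg =>
    simp only [codeRules, List.cons_subset, List.append_subset] at hc
    simp only [Code.eval, Seq.seq, Part.map_eq_map, Part.bind_map, Part.mem_bind_iff,
      Part.mem_map_iff] at h
    obtain ⟨x, hx, y, hy, rfl⟩ := h
    exact of_rule hc.1 [n, x, y, Nat.pair x y]
      (by simpa [pr hP] using ⟨hf hc.2.1 hx, hg hc.2.2 hy⟩)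
  | comp f g hf hg =>
    simp only [codeRules, List.cons_subset, List.append_subset] at hc
    obtain ⟨x, hx, hm⟩ := Part.mem_bind_iff.1 h
    exact of_rule hc.1 [n, x, m] (by simpa using ⟨hg hc.2.2 hx, hf hc.2.1 hm⟩)
  | prec f g hf hg =>
    simp only [codeRules, List.cons_subset, List.append_subset] at hc
    obtain ⟨h1, h2, hcf, hcg⟩ := hc
    rw [← Nat.pair_unpair n] at h ⊢
    generalize n.unpair.1 = a at h ⊢
    generalize n.unpair.2 = k at h ⊢
    induction k generalizing m with
    | zero =>
      rw [Code.eval_prec_zero] at h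
      exact of_rule h1 [a, 0, Nat.pair a 0, m] (by simpa [zero, pr hP] using hf hcf h)
    | succ k ih =>
      obtain ⟨i, hi, hm⟩ := mem_eval_prec_succ.1 h
      exact of_rule h2 [a, k, Nat.pair a k, i, k + 1, Nat.pair a (k + 1), Nat.pair k i,
        Nat.pair a (Nat.pair k i), m] (by simpa [suc, pr hP] using ⟨ih hi, hg hcg hm⟩)
  | rfind' f hf =>
    simp only [codeRules, List.cons_subset] at hc
    obtain ⟨h1, h2, hcf⟩ := hc
    rw [← Nat.pair_unpair n] at h ⊢
    generalize n.unpair.1 = a at h ⊢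
    generalize n.unpair.2 = x at h ⊢
    obtain ⟨k, rfl, h0, hk⟩ := mem_eval_rfind'.1 h
    clear h
    induction k generalizing x with
    | zero =>
      rw [zero_add] at h0 ⊢
      exact of_rule h1 [a, x, Nat.pair a x, 0] (by simpa [zero, pr hP] using hf hcf h0)
    | succ k ih =>
      obtain ⟨y, hy⟩ := hk 0 (by omega)
      rw [zero_add] at hy
      have e1 : k + 1 + x = k + (x + 1) := by omega
      rw [e1] at h0 ⊢
      have := ih (x + 1) h0 fun j hj => by
        obtain ⟨z, hz⟩ := hk (j + 1) (by omega)
        exact ⟨z, by rwa [show j + (x + 1) = j + 1 + x by omega]⟩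
      exact of_rule h2 [a, x, Nat.pair a x, y + 1, y, x + 1, Nat.pair a (x + 1), k + (x + 1)]
        (by simpa [suc, pr hP] using ⟨hf hcf hy, this⟩)

theorem input {a : ℕ} (h : inputRule a ∈ P) : Der P e .input [a] := by
  refine rule _ h id ?_
  simp only [inputRule, List.mem_cons, List.mem_map]
  rintro b (rfl | ⟨i, -, rfl⟩)
  · exact zero
  · exact suc i

theorem ver {c : Code} {R : ℕ → List ℕ → Bool} (hc : Decides c R) (a : ℕ) (k : List ℕ)
    (hk : Rejected R a k) : Der (arithRules c a) e .ver [Encodable.encode k] := by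
  have hP : pairingRules ⊆ arithRules c a := fun r hr => by simp [arithRules, hr]
  have hC : codeRules c ⊆ arithRules c a := fun r hr => by simp [arithRules, hr]
  have hV : verRules c ⊆ arithRules c a := fun r hr => by simp [arithRules, hr]
  have hI : Der (arithRules c a) e .input [a] := input (by simp [arithRules])
  simp only [verRules, List.cons_subset] at hV
  induction k with
  | nil =>
    rw [rejected_nil] at hk
    have h := ev (e := e) hP c hC (hc.mem (k := []).2 hk)
    exact of_rule hV.1 [0, a, Nat.pair a 0] (by simpa [zero, hI, pr hP] using h)
  | cons n k ih =>
    rw [rejected_cons] at hk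
    have h := ev (e := e) hP c hC (hc.mem.2 hk.1)
    rw [Encodable.encode_list_cons] at h ⊢
    exact of_rule hV.2.1 [Encodable.encode k, n, Nat.pair n (Encodable.encode k),
      Nat.pair n (Encodable.encode k) + 1, a, Nat.pair a (Nat.pair n (Encodable.encode k) + 1), 0]
      (by simpa [zero, suc, hI, pr hP, ih hk.2] using h)

theorem cand {c : Code} {R : ℕ → List ℕ → Bool} (hc : Decides c R) (a n : ℕ) (k : List ℕ)
    (hk : Rejected R a (n :: k)) :
    Der (arithRules c a) (Encodable.encode k) .cand [Encodable.encode (n :: k)] := by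
  have hP : pairingRules ⊆ arithRules c a := fun r hr => by simp [arithRules, hr]
  have hV : verRules c ⊆ arithRules c a := fun r hr => by simp [arithRules, hr]
  simp only [verRules, List.cons_subset] at hV
  have h := ver (e := Encodable.encode k) hc a _ hk
  rw [Encodable.encode_list_cons] at h ⊢
  exact of_rule hV.2.2.1 [Encodable.encode k, n, Nat.pair n (Encodable.encode k),
    Nat.pair n (Encodable.encode k) + 1] (by simpa [st, suc, pr hP] using h)

end Der

/-! ### The rule set -/

/-- Every number has a successor; all created numbers are possible picks. -/
def genRule : Rule :=
  ([atm .brake [0], atm .num [0, 1], atm .grow [0, 1, 0]],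
    [atm .grow [0, 1, 2], atm .num [0, 2], atm .grow [0, 2, 0], atm .pick [0, 2, 0]])

/-- Pulling a brake blocks the creation of numbers and eras. -/
def pullRule : Rule :=
  ([atm .brake [0]],
    [atm .num [0, 0], atm .grow [0, 0, 0], atm .pick [0, 0, 0], atm .zero [0, 0],
      atm .child [0, 0]])

/-- A candidate that is picked starts a new era, with its own brake and number zero. -/
def eraRule : Rule :=
  ([atm .brake [0], atm .cand [0, 1], atm .pick [0, 1, 0]],
    [atm .pick [0, 1, 2], atm .child [0, 2], atm .brake [2], atm .zero [2, 3], atm .num [2, 3],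
      atm .grow [2, 3, 2], atm .pick [2, 3, 2]])

/-- Created numbers are linked by the successor relation. -/
def sucRule : Rule := ([atm .grow [0, 1, 2], atm .num [0, 2]], [atm .suc [0, 1, 2]])

/-- Zero of an era corresponds to zero of the next era. -/
def copyZeroRule : Rule :=
  ([atm .child [0, 1], atm .zero [0, 2], atm .zero [1, 3]], [atm .copy [0, 1, 2, 3]])

/-- The correspondence of numbers is compatible with successors. -/
def copySucRule : Rule :=
  ([atm .copy [0, 1, 2, 3], atm .suc [0, 2, 4], atm .suc [1, 3, 5]], [atm .copy [0, 1, 4, 5]])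

/-- The state of an era is the number picked in the previous era. -/
def stRule : Rule :=
  ([atm .child [0, 1], atm .pick [0, 2, 1], atm .copy [0, 1, 2, 3]], [atm .st [1, 3]])

/-- The rule set assigned to the code `c` and the input `a`. -/
def ruleSet (c : Code) (a : ℕ) : RuleSet :=
  genRule :: pullRule :: eraRule :: sucRule :: copyZeroRule :: copySucRule :: stRule ::
    (arithRules c a).map ArithRule.toRule

theorem ruleSet_cases {c : Code} {a : ℕ} {p : Rule → Prop} (hg : p genRule) (hp : p pullRule)
    (he : p eraRule) (hs : p sucRule) (h0 : p copyZeroRule) (h1 : p copySucRule) (h2 : p stRule)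
    (ha : ∀ r ∈ arithRules c a, p r.toRule) : ∀ r ∈ ruleSet c a, p r := by
  simp only [ruleSet, List.forall_mem_cons, List.forall_mem_map]
  exact ⟨hg, hp, he, hs, h0, h1, h2, ha⟩

theorem ruleSet_isRuleSet (c : Code) (a : ℕ) : IsRuleSet (ruleSet c a) := by
  apply ruleSet_cases
  case ha =>
    intro r _
    refine ⟨by simp [ArithRule.toRule], ?_⟩
    simp only [ArithRule.toRule, List.mem_append, List.mem_map, List.mem_singleton]
    rintro _ (⟨b, -, rfl⟩ | rfl) <;> exact atomNullFree_atm _ _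
  all_goals
    simp [IsRule, genRule, pullRule, eraRule, sucRule, copyZeroRule, copySucRule, stRule,
      atomNullFree_atm]

theorem atm_vars (s : PSym) (l : List ℕ) : ∀ x ∈ (atm s l).2, ∃ v, x = Sum.inl v := by
  simp only [atm, List.mem_map]
  rintro _ ⟨v, -, rfl⟩
  exact ⟨v, rfl⟩

theorem ruleSet_head_vars (c : Code) (a : ℕ) :
    ∀ r ∈ ruleSet c a, ∀ b ∈ r.2, ∀ x ∈ b.2, ∃ v, x = Sum.inl v := by
  apply ruleSet_cases
  case ha =>
    intro r _ b hb
    rw [ArithRule.toRule, List.mem_singleton] at hb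
    exact hb ▸ atm_vars _ _
  all_goals
    simp only [genRule, pullRule, eraRule, sucRule, copyZeroRule, copySucRule, stRule,
      List.forall_mem_cons]
    and_intros <;> first | exact atm_vars _ _ | simp

theorem inputRule_toRule (a : ℕ) : (inputRule a).toRule =
    (atm .zero [0, 1] :: (List.range a).map (fun i => atm .suc [0, i + 1, i + 2]),
      [atm .input [0, a + 1]]) := by
  simp [ArithRule.toRule, inputRule, Function.comp_def]

theorem ruleSet_computable (c : Code) : Computable (ruleSet c) := by
  have hv : Primrec fun n : ℕ => (Sum.inl n : RTerm) := Primrec.sumInl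
  have hs : Primrec fun n : ℕ => n + 1 := Primrec.succ
  have h1 : Primrec fun i : ℕ => atm .suc [0, i + 1, i + 2] := by
    unfold atm
    exact (Primrec.const _).pair (Primrec.list_cons.comp (Primrec.const _)
      (Primrec.list_cons.comp (hv.comp hs)
        (Primrec.list_cons.comp (hv.comp (hs.comp hs)) (Primrec.const _))))
  have h2 : Primrec fun i : ℕ => atm .input [0, i + 1] := by
    unfold atm
    exact (Primrec.const _).pair (Primrec.list_cons.comp (Primrec.const _)
      (Primrec.list_cons.comp (hv.comp hs) (Primrec.const _)))
  have h3 : Primrec fun a : ℕ => (inputRule a).toRule := by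
    simp only [inputRule_toRule]
    exact (Primrec.list_cons.comp (Primrec.const _)
      (Primrec.list_map Primrec.list_range (h1.comp₂ Primrec₂.right))).pair
      (Primrec.list_cons.comp h2 (Primrec.const _))
  have h4 : Primrec (ruleSet c) := by
    unfold ruleSet arithRules
    simp only [List.map_cons]
    iterate 7 refine Primrec.list_cons.comp (Primrec.const _) ?_
    exact Primrec.list_cons.comp h3 (Primrec.const _)
  exact h4.to_comp

/-! ### Infinite chase derivations -/

namespace Chase

variable {S : RuleSet} {D : Set Fact} (C : Chase S D)

theorem fact_mono : Monotone C.fact := by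
  refine monotone_nat_of_le_succ fun i => ?_
  by_cases h : (i : ℕ∞) < C.len
  · rw [C.succ i h]
    exact Set.subset_union_left
  · rw [C.stall i h]

variable {C} (hC : IsInfinite C)
include hC

theorem lt_len (i : ℕ) : (i : ℕ∞) < C.len := by
  rw [show C.len = ⊤ from hC]
  exact ENat.natCast_lt_top i

theorem fact_succ (i : ℕ) : C.fact (i + 1) = C.fact i ∪ outputOf (C.trig i) (C.ext i) :=
  C.succ i (lt_len hC i)

theorem trig_mem (i : ℕ) : (C.trig i).1 ∈ S := (C.activeAt i (lt_len hC i)).1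

theorem body_mem (i : ℕ) : ∀ a ∈ (C.trig i).1.1, applyA (C.ext i) a ∈ C.fact i := by
  intro a ha
  have h := (C.activeAt i (lt_len hC i)).2.1 a ha
  convert h using 1
  refine Prod.ext rfl (List.map_congr_left fun t ht => ?_)
  rcases t with v | g
  · exact (C.extOk i (lt_len hC i)).1 v ⟨a, ha, ht⟩
  · rfl

theorem head_mem (i : ℕ) : ∀ a ∈ (C.trig i).1.2, applyA (C.ext i) a ∈ C.fact (i + 1) := by
  intro a ha
  rw [fact_succ hC]
  exact Or.inr ⟨a, ha, rfl⟩

theorem not_obsolete (i : ℕ) {σ : ℕ → GroundTerm}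
    (hσ : ∀ v, bodyVar (C.trig i).1 v → σ v = C.ext i v) :
    ∃ a ∈ (C.trig i).1.2, applyA σ a ∉ C.fact i := by
  have h := (C.activeAt i (lt_len hC i)).2.2
  by_contra! h'
  refine h ⟨σ, fun v hv => ?_, h'⟩
  rw [hσ v hv, (C.extOk i (lt_len hC i)).1 v hv]

theorem ext_fresh {i v : ℕ} (hv : existVar (C.trig i).1 v) : C.ext i v ∉ termsOf (C.fact i) := by
  obtain ⟨n, hn, h⟩ := (C.extOk i (lt_len hC i)).2.1 v hv
  rwa [hn]

theorem ext_mem {i v : ℕ} (hv : existVar (C.trig i).1 v) :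
    C.ext i v ∈ termsOf (C.fact (i + 1)) := by
  obtain ⟨⟨a, ha, hav⟩, -⟩ := hv
  exact ⟨_, head_mem hC i a ha, List.mem_map.2 ⟨_, hav, rfl⟩⟩

theorem ext_body_mem {i v : ℕ} (hv : bodyVar (C.trig i).1 v) :
    C.ext i v ∈ termsOf (C.fact i) := by
  obtain ⟨a, ha, hav⟩ := hv
  exact ⟨_, body_mem hC i a ha, List.mem_map.2 ⟨_, hav, rfl⟩⟩

theorem ext_inj {i j v w : ℕ} (hv : existVar (C.trig i).1 v) (hw : existVar (C.trig j).1 w)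
    (h : C.ext i v = C.ext j w) : i = j ∧ v = w := by
  have key : ∀ {i j v w : ℕ}, existVar (C.trig i).1 v → existVar (C.trig j).1 w →
      C.ext i v = C.ext j w → ¬ i < j := by
    intro i j v w hv hw h hij
    refine ext_fresh hC hw ?_
    obtain ⟨f, hf, hf'⟩ := ext_mem hC hv
    exact ⟨f, C.fact_mono (by omega) hf, h ▸ hf'⟩
  have : i = j := le_antisymm (not_lt.1 (key hw hv h.symm)) (not_lt.1 (key hv hw h))
  subst this
  exact ⟨rfl, (C.extOk i (lt_len hC i)).2.2 v w hv hw h⟩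

theorem ext_ne {i v w : ℕ} (hv : bodyVar (C.trig i).1 v) (hw : existVar (C.trig i).1 w) :
    C.ext i v ≠ C.ext i w :=
  fun h => ext_fresh hC hw (h ▸ ext_body_mem hC hv)

end Chase

theorem existVar_genRule : existVar genRule 2 := by
  simp [existVar, bodyVar, genRule]

theorem existVar_eraRule_brake : existVar eraRule 2 := by
  simp [existVar, bodyVar, eraRule]

theorem existVar_eraRule_zero : existVar eraRule 3 := by
  simp [existVar, bodyVar, eraRule]

section

variable {c : Code} {a : ℕ} {D : Set Fact} {C : Chase (ruleSet c a) D}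

/-- The arithmetical rule `r` is applied in step `t` and yields the fact `fct s l`. -/
def ArithOut (C : Chase (ruleSet c a) D) (t : ℕ) (s : PSym) (l : List GroundTerm) : Prop :=
  ∃ r ∈ arithRules c a, (C.trig t).1 = r.toRule ∧ s = r.2.1 ∧
    l = C.ext t 0 :: r.2.2.map fun x => C.ext t (x + 1)

theorem ArithOut.derived {t : ℕ} {s : PSym} {l : List GroundTerm} (h : ArithOut C t s l) :
    s.Derived := by
  obtain ⟨r, hr, -, rfl, -⟩ := h
  exact (arithRules_wf c a r hr).1

/-- The facts that may be added in a step. -/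
def StepOut (C : Chase (ruleSet c a) D) (t : ℕ) (s : PSym) (l : List GroundTerm) : Prop :=
  let e := C.ext t
  ((C.trig t).1 = genRule ∧
    ((s = .grow ∧ l = [e 0, e 1, e 2]) ∨ (s = .num ∧ l = [e 0, e 2]) ∨
      (s = .grow ∧ l = [e 0, e 2, e 0]) ∨ (s = .pick ∧ l = [e 0, e 2, e 0]))) ∨
  ((C.trig t).1 = pullRule ∧
    ((s = .num ∧ l = [e 0, e 0]) ∨ (s = .grow ∧ l = [e 0, e 0, e 0]) ∨
      (s = .pick ∧ l = [e 0, e 0, e 0]) ∨ (s = .zero ∧ l = [e 0, e 0]) ∨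
      (s = .child ∧ l = [e 0, e 0]))) ∨
  ((C.trig t).1 = eraRule ∧
    ((s = .pick ∧ l = [e 0, e 1, e 2]) ∨ (s = .child ∧ l = [e 0, e 2]) ∨
      (s = .brake ∧ l = [e 2]) ∨ (s = .zero ∧ l = [e 2, e 3]) ∨ (s = .num ∧ l = [e 2, e 3]) ∨
      (s = .grow ∧ l = [e 2, e 3, e 2]) ∨ (s = .pick ∧ l = [e 2, e 3, e 2]))) ∨
  ((C.trig t).1 = sucRule ∧ s = .suc ∧ l = [e 0, e 1, e 2]) ∨
  ((C.trig t).1 = copyZeroRule ∧ s = .copy ∧ l = [e 0, e 1, e 2, e 3]) ∨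
  ((C.trig t).1 = copySucRule ∧ s = .copy ∧ l = [e 0, e 1, e 4, e 5]) ∨
  ((C.trig t).1 = stRule ∧ s = .st ∧ l = [e 1, e 3]) ∨
  ArithOut C t s l

theorem mem_fact_succ (hC : IsInfinite C) {t : ℕ} {s : PSym} {l : List GroundTerm}
    (h : fct s l ∈ C.fact (t + 1)) : fct s l ∈ C.fact t ∨ StepOut C t s l := by
  rw [Chase.fact_succ hC] at h
  refine h.imp_right fun h => ?_
  have key : ∀ r ∈ ruleSet c a, (C.trig t).1 = r → StepOut C t s l := by
    apply ruleSet_cases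
    case ha =>
      intro r hr e
      obtain ⟨b, hb, hf⟩ := h
      rw [e, ArithRule.toRule, List.mem_singleton] at hb
      subst hb
      rw [applyA_atm, fct_inj] at hf
      refine .inr <| .inr <| .inr <| .inr <| .inr <| .inr <| .inr ⟨r, hr, e, hf.1, ?_⟩
      simp [hf.2, Function.comp_def]
    all_goals
      intro e
      obtain ⟨b, hb, hf⟩ := h
      rw [e] at hb
      simp only [genRule, pullRule, eraRule, sucRule, copyZeroRule, copySucRule, stRule,
        List.mem_cons, List.not_mem_nil, or_false] at hb
      simp only [StepOut, e, true_and]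
      aesop
  exact key _ (Chase.trig_mem hC t) rfl

end

/-! ### Numbers created by a chase derivation -/

section

variable {c : Code} {a : ℕ} {D : Set Fact} {C : Chase (ruleSet c a) D}

/-- `Hon C w x n` says that `x` was created to represent the number `n` in the era of `w`. -/
inductive Hon (C : Chase (ruleSet c a) D) : GroundTerm → GroundTerm → ℕ → Prop
  | zero (i : ℕ) (h : (C.trig i).1 = eraRule) : Hon C (C.ext i 2) (C.ext i 3) 0
  | succ (i n : ℕ) (h : (C.trig i).1 = genRule) (hn : Hon C (C.ext i 0) (C.ext i 1) n) :
      Hon C (C.ext i 0) (C.ext i 2) (n + 1)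

theorem Hon.unique (hC : IsInfinite C) {w x w' : GroundTerm} {n m : ℕ} (h : Hon C w x n)
    (h' : Hon C w' x m) : n = m := by
  induction h generalizing w' m with
  | zero i h =>
    generalize hx : C.ext i 3 = x at h'
    cases h' with
    | zero => rfl
    | succ j n hj =>
      have := Chase.ext_inj hC (h ▸ existVar_eraRule_zero) (hj ▸ existVar_genRule) hx
      omega
  | succ i n h hn ih =>
    generalize hx : C.ext i 2 = x at h'
    cases h' with
    | zero j hj =>
      have := Chase.ext_inj hC (h ▸ existVar_genRule) (hj ▸ existVar_eraRule_zero) hx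
      omega
    | succ j m hj hm =>
      obtain ⟨rfl, -⟩ := Chase.ext_inj hC (h ▸ existVar_genRule) (hj ▸ existVar_genRule) hx
      rw [ih hm]

theorem Hon.ne (hC : IsInfinite C) {w x : GroundTerm} {n : ℕ} (h : Hon C w x n) : x ≠ w := by
  cases h with
  | zero i h =>
    intro e
    have := Chase.ext_inj hC (h ▸ existVar_eraRule_zero) (h ▸ existVar_eraRule_brake) e
    omega
  | succ i n h hn =>
    exact (Chase.ext_ne hC (by simp [h, bodyVar, genRule]) (h ▸ existVar_genRule)).symm

theorem Hon.exists_era {w x : GroundTerm} {n : ℕ} (h : Hon C w x n) :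
    ∃ i, (C.trig i).1 = eraRule ∧ C.ext i 2 = w := by
  induction h with
  | zero i h => exact ⟨i, h, rfl⟩
  | succ i n h hn ih => exact ih

theorem era_ne (hC : IsInfinite C) {i : ℕ} (h : (C.trig i).1 = eraRule) :
    C.ext i 0 ≠ C.ext i 2 :=
  Chase.ext_ne hC (by simp [h, bodyVar, eraRule]) (h ▸ existVar_eraRule_brake)

/-- The numbers represented by the pick that started the era of step `i`. -/
def eraState (C : Chase (ruleSet c a) D) (i : ℕ) : Set ℕ :=
  {n | ∀ m, Hon C (C.ext i 0) (C.ext i 1) m → n = m}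

/-- The invariant for the era created in step `i`. -/
structure EraInv (C : Chase (ruleSet c a) D) (R : ℕ → List ℕ → Bool) (i : ℕ) (F : Set Fact) :
    Prop where
  pulled : fct .num [C.ext i 2, C.ext i 2] ∈ F →
    ∀ b ∈ pullRule.2, applyA (fun _ => C.ext i 2) b ∈ F
  child : ∀ u, fct .child [u, C.ext i 2] ∈ F →
    u = C.ext i 0 ∨ (u = C.ext i 2 ∧ fct .num [C.ext i 2, C.ext i 2] ∈ F)
  pick : ∀ u s, fct .pick [u, s, C.ext i 2] ∈ F →
    u = C.ext i 2 ∨ (u = C.ext i 0 ∧ s = C.ext i 1)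
  grow : ∀ x y, fct .grow [C.ext i 2, x, y] ∈ F →
    y = C.ext i 2 ∨ ∃ m, Hon C (C.ext i 2) x m ∧ Hon C (C.ext i 2) y (m + 1)
  zero : ∀ x, fct .zero [C.ext i 2, x] ∈ F → x = C.ext i 2 ∨ Hon C (C.ext i 2) x 0
  suc : ∀ x y, fct .suc [C.ext i 2, x, y] ∈ F →
    y = C.ext i 2 ∨ ∃ m, Hon C (C.ext i 2) x m ∧ Hon C (C.ext i 2) y (m + 1)
  arith : fct .num [C.ext i 2, C.ext i 2] ∉ F → ∀ s : PSym, s.Arith → ∀ xs,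
    fct s (C.ext i 2 :: xs) ∈ F →
      ∃ ns, List.Forall₂ (Hon C (C.ext i 2)) xs ns ∧ Interp (Rejected R a) a (eraState C i) s ns
  copy : fct .num [C.ext i 2, C.ext i 2] ∉ F → ∀ u x x', fct .copy [u, C.ext i 2, x, x'] ∈ F →
    (∃ n, Hon C (C.ext i 2) x' n) ∧ ∀ m, Hon C u x m → Hon C (C.ext i 2) x' m

theorem EraInv.of_fresh {R : ℕ → List ℕ → Bool} {i : ℕ} {F : Set Fact}
    (h : C.ext i 2 ∉ termsOf F) : EraInv C R i F := by
  have key : ∀ s l, C.ext i 2 ∈ l → fct s l ∉ F := fun s l hl hF => h ⟨_, hF, hl⟩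
  constructor
  · exact fun h => absurd h (key _ _ (by simp))
  · exact fun _ h => absurd h (key _ _ (by simp))
  · exact fun _ _ h => absurd h (key _ _ (by simp))
  · exact fun _ _ h => absurd h (key _ _ (by simp))
  · exact fun _ h => absurd h (key _ _ (by simp))
  · exact fun _ _ h => absurd h (key _ _ (by simp))
  · exact fun _ _ _ _ h => absurd h (key _ _ (by simp))
  · exact fun _ _ _ _ h => absurd h (key _ _ (by simp))

/-- The brake of an applied generating rule has not been pulled. -/
theorem gen_unpulled (hC : IsInfinite C) {t : ℕ} (h : (C.trig t).1 = genRule) :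
    ¬ ∀ b ∈ pullRule.2, applyA (fun _ => C.ext t 0) b ∈ C.fact t := by
  intro hp
  have hb := Chase.body_mem hC t
  obtain ⟨b, hb', hF⟩ := Chase.not_obsolete hC t
    (σ := Function.update (C.ext t) 2 (C.ext t 0)) (by
      simp only [h, bodyVar, genRule]
      intro v hv
      rw [Function.update_of_ne]
      rintro rfl
      simp at hv)
  rw [h] at hb' hb
  simp [genRule] at hb
  simp [pullRule] at hp
  simp only [genRule, List.mem_cons, List.not_mem_nil, or_false] at hb'
  rcases hb' with rfl | rfl | rfl | rfl <;> simp_all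

/-- The brake of an applied era rule has not been pulled. -/
theorem era_unpulled (hC : IsInfinite C) {t : ℕ} (h : (C.trig t).1 = eraRule) :
    ¬ ∀ b ∈ pullRule.2, applyA (fun _ => C.ext t 0) b ∈ C.fact t := by
  intro hp
  have hb := Chase.body_mem hC t
  obtain ⟨b, hb', hF⟩ := Chase.not_obsolete hC t
    (σ := Function.update (Function.update (C.ext t) 2 (C.ext t 0)) 3 (C.ext t 0)) (by
      simp only [h, bodyVar, eraRule]
      intro v hv
      rw [Function.update_of_ne, Function.update_of_ne] <;>
      · rintro rfl
        simp at hv)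
  rw [h] at hb' hb
  simp [eraRule] at hb
  simp [pullRule] at hp
  simp only [eraRule, List.mem_cons, List.not_mem_nil, or_false] at hb'
  rcases hb' with rfl | rfl | rfl | rfl | rfl | rfl | rfl <;> simp_all

theorem arith_out {R : ℕ → List ℕ → Bool} (hC : IsInfinite C) (hR : Decides c R) {i t : ℕ}
    (ih : EraInv C R i (C.fact t)) (hp : fct .num [C.ext i 2, C.ext i 2] ∉ C.fact t)
    {s : PSym} {xs : List GroundTerm} (h : ArithOut C t s (C.ext i 2 :: xs)) :
    ∃ ns, List.Forall₂ (Hon C (C.ext i 2)) xs ns ∧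
      Interp (Rejected R a) a (eraState C i) s ns := by
  obtain ⟨r, hr, e, rfl, hl⟩ := h
  obtain ⟨hw, rfl⟩ := List.cons.inj hl
  have hb := Chase.body_mem hC t
  rw [e] at hb
  simp only [ArithRule.toRule, List.mem_map, forall_exists_index, and_imp,
    forall_apply_eq_imp_iff₂, applyA_atm, List.map_cons, List.map_map, ← hw] at hb
  obtain ⟨-, hwb, hwh, -⟩ := arithRules_wf c a r hr
  classical
  let v : ℕ → ℕ := fun x =>
    if hx : ∃ n, Hon C (C.ext i 2) (C.ext t (x + 1)) n then hx.choose else 0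
  have hv : ∀ x n, Hon C (C.ext i 2) (C.ext t (x + 1)) n → v x = n := by
    intro x n hn
    have hx : ∃ n, Hon C (C.ext i 2) (C.ext t (x + 1)) n := ⟨n, hn⟩
    simp only [v, dif_pos hx]
    exact hx.choose_spec.unique hC hn
  have key : ∀ (l : List ℕ) (ns : List ℕ),
      List.Forall₂ (Hon C (C.ext i 2)) (l.map fun x => C.ext t (x + 1)) ns →
      ns = l.map v ∧ ∀ x ∈ l, Hon C (C.ext i 2) (C.ext t (x + 1)) (v x) := by
    intro l
    induction l with
    | nil => simp
    | cons x l ihl =>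
      intro ns hns
      rw [List.map_cons] at hns
      cases hns with
      | cons h1 h2 =>
        obtain ⟨rfl, h3⟩ := ihl _ h2
        obtain rfl := hv _ _ h1
        simpa using ⟨h1, h3⟩
  have hbody : ∀ b ∈ r.1, Interp (Rejected R a) a (eraState C i) b.1 (b.2.map v) ∧
      ∀ x ∈ b.2, Hon C (C.ext i 2) (C.ext t (x + 1)) (v x) := by
    intro b hb'
    obtain ⟨ns, h1, h2⟩ := ih.arith hp b.1 (hwb b hb') _ (hb b hb')
    obtain ⟨rfl, h3⟩ := key _ _ h1
    exact ⟨h2, h3⟩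
  refine ⟨r.2.2.map v, ?_, arithRules_valid hR a _ r hr v fun b hb => (hbody b hb).1⟩
  rw [List.forall₂_map_left_iff, List.forall₂_map_right_iff, List.forall₂_same]
  intro x hx
  obtain ⟨b, hb, hxb⟩ := hwh x hx
  exact (hbody b hb).2 x hxb

theorem EraInv.succ {R : ℕ → List ℕ → Bool} (hC : IsInfinite C) (hR : Decides c R) {t : ℕ}
    (ih : ∀ i, (C.trig i).1 = eraRule → EraInv C R i (C.fact t)) {i : ℕ}
    (hi : (C.trig i).1 = eraRule) : EraInv C R i (C.fact (t + 1)) := by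
  have hb := Chase.body_mem hC t
  have hh := Chase.head_mem hC t
  have hsub : C.fact t ⊆ C.fact (t + 1) := C.fact_mono (Nat.le_succ t)
  have hera : ∀ {t : ℕ}, (C.trig t).1 = eraRule → C.ext i 2 = C.ext t 2 → i = t := fun h e =>
    (Chase.ext_inj hC (hi ▸ existVar_eraRule_brake) (h ▸ existVar_eraRule_brake) e).1
  have hera3 : (C.trig t).1 = eraRule → C.ext t 3 ≠ C.ext t 2 := fun h =>
    (Hon.zero t h).ne hC
  have hgen : (C.trig t).1 = genRule → C.ext t 2 ≠ C.ext t 0 := fun h =>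
    (Chase.ext_ne hC (by simp [h, bodyVar, genRule]) (h ▸ existVar_genRule)).symm
  have hunp : (C.trig t).1 = genRule → C.ext t 0 = C.ext i 2 →
      fct .num [C.ext i 2, C.ext i 2] ∉ C.fact t := fun h h0 h1 =>
    gen_unpulled hC h (by rw [h0]; exact (ih i hi).pulled h1)
  have hgrow : (C.trig t).1 = genRule → C.ext t 0 = C.ext i 2 →
      ∃ m, Hon C (C.ext i 2) (C.ext t 1) m ∧ Hon C (C.ext i 2) (C.ext t 2) (m + 1) := by
    intro h h0
    have hb' := hb
    rw [h] at hb'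
    simp [genRule, h0] at hb'
    obtain ⟨ns, h1, m, rfl⟩ := (ih i hi).arith (hunp h h0) .num trivial _ hb'.2.1
    have h2 : Hon C (C.ext i 2) (C.ext t 1) m := by simpa using h1
    exact ⟨m, h2, h0 ▸ Hon.succ t m h (h0 ▸ h2)⟩
  have hpull : (C.trig t).1 = pullRule → C.ext t 0 = C.ext i 2 →
      ∀ b ∈ pullRule.2, applyA (fun _ => C.ext i 2) b ∈ C.fact (t + 1) := by
    intro h h0
    rw [h] at hh
    simp [pullRule, h0] at hh
    simpa [pullRule] using hh
  have hsuc : (C.trig t).1 = sucRule → C.ext t 0 = C.ext i 2 →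
      fct .grow [C.ext i 2, C.ext t 1, C.ext t 2] ∈ C.fact t ∧
      fct .num [C.ext i 2, C.ext t 2] ∈ C.fact t := by
    intro h h0
    rw [h] at hb
    simpa [sucRule, h0] using hb
  constructor
  · intro h
    replace h := mem_fact_succ hC h
    rcases h with h | h
    · exact fun b hb => hsub ((ih i hi).pulled h b hb)
    · have nd : ∀ l, ¬ ArithOut C t .num l := fun l h => h.derived
      simp [StepOut, nd] at h
      rcases h with ⟨h, h0, h1⟩ | ⟨h, h0⟩ | ⟨h, h0, h1⟩
      · exact absurd (h1.symm.trans h0) (hgen h)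
      · exact hpull h h0.symm
      · exact absurd (h1.symm.trans h0) (hera3 h)
  · intro u h
    replace h := mem_fact_succ hC h
    rcases h with h | h
    · exact ((ih i hi).child u h).imp_right fun h => ⟨h.1, hsub h.2⟩
    · have nd : ∀ l, ¬ ArithOut C t .child l := fun l h => h.derived
      simp [StepOut, nd] at h
      rcases h with ⟨h, h0, h1⟩ | ⟨h, h0, h1⟩
      · exact .inr ⟨h0.trans h1.symm, by simpa using hpull h h1.symm _ (.head _)⟩
      · obtain rfl := hera h h1
        exact .inl h0
  · intro u s h
    replace h := mem_fact_succ hC h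
    rcases h with h | h
    · exact (ih i hi).pick u s h
    · have nd : ∀ l, ¬ ArithOut C t .pick l := fun l h => h.derived
      simp [StepOut, nd] at h
      rcases h with ⟨h, h0, h1, h2⟩ | ⟨h, h0, h1, h2⟩ | ⟨h, ⟨h0, h1, h2⟩ | ⟨h0, h1, h2⟩⟩
      · exact .inl (h0.trans h2.symm)
      · exact .inl (h0.trans h2.symm)
      · obtain rfl := hera h h2
        exact .inr ⟨h0, h1⟩
      · exact .inl (h0.trans h2.symm)
  · intro x y h
    replace h := mem_fact_succ hC h
    rcases h with h | h
    · exact (ih i hi).grow x y h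
    · have nd : ∀ l, ¬ ArithOut C t .grow l := fun l h => h.derived
      simp [StepOut, nd] at h
      rcases h with ⟨h, ⟨h0, rfl, rfl⟩ | ⟨h0, h1, h2⟩⟩ | ⟨h, h0, h1, h2⟩ | ⟨h, h0, h1, h2⟩
      · exact .inr (hgrow h h0.symm)
      all_goals exact .inl (h2.trans h0.symm)
  · intro x h
    replace h := mem_fact_succ hC h
    rcases h with h | h
    · exact (ih i hi).zero x h
    · have nd : ∀ l, ¬ ArithOut C t .zero l := fun l h => h.derived
      simp [StepOut, nd] at h
      rcases h with ⟨h, h0, h1⟩ | ⟨h, h0, rfl⟩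
      · exact .inl (h1.trans h0.symm)
      · exact .inr (h0 ▸ Hon.zero t h)
  · intro x y h
    replace h := mem_fact_succ hC h
    rcases h with h | h
    · exact (ih i hi).suc x y h
    · have nd : ∀ l, ¬ ArithOut C t .suc l := fun l h => h.derived
      simp [StepOut, nd] at h
      obtain ⟨h, h0, rfl, rfl⟩ := h
      exact (ih i hi).grow _ _ (hsuc h h0.symm).1
  · intro hp s hs xs h
    replace hp' := fun h => hp (hsub h)
    replace h := mem_fact_succ hC h
    rcases h with h | h
    · exact (ih i hi).arith hp' s hs xs h
    · by_cases ha : ArithOut C t s (C.ext i 2 :: xs)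
      · exact arith_out hC hR (ih i hi) hp' ha
      simp only [StepOut, ha, or_false] at h
      rcases h with ⟨h, h0⟩ | ⟨h, h0⟩ | ⟨h, h0⟩ | ⟨h, rfl, h0⟩ | ⟨h, rfl, h0⟩ | ⟨h, rfl, h0⟩ |
        ⟨h, rfl, h0⟩
      · rcases h0 with ⟨rfl, h0⟩ | ⟨rfl, h0⟩ | ⟨rfl, h0⟩ | ⟨rfl, h0⟩ <;> try exact hs.elim
        replace h0 := List.cons.inj h0
        obtain ⟨h0, rfl⟩ := h0
        obtain ⟨m, -, hm⟩ := hgrow h h0.symm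
        exact ⟨[m + 1], by simpa using hm, m + 1, rfl⟩
      · refine absurd ?_ hp
        refine (by simpa using hpull h · _ (.head _)) ?_
        simp only [List.cons.injEq] at h0
        rcases h0 with h0 | h0 | h0 | h0 | h0 <;> exact h0.2.1.symm
      · rcases h0 with ⟨rfl, h0⟩ | ⟨rfl, h0⟩ | ⟨rfl, h0⟩ | ⟨rfl, h0⟩ | ⟨rfl, h0⟩ | ⟨rfl, h0⟩ |
          ⟨rfl, h0⟩ <;> try exact hs.elim
        all_goals
          replace h0 := List.cons.inj h0
          obtain ⟨h0, rfl⟩ := h0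
          exact ⟨[0], by simpa [h0] using Hon.zero t h, by simp [Interp]⟩
      · replace h0 := List.cons.inj h0
        obtain ⟨h0, rfl⟩ := h0
        obtain ⟨h1, h2⟩ := hsuc h h0.symm
        rcases (ih i hi).grow _ _ h1 with h3 | ⟨m, h3, h4⟩
        · rw [h3] at h2
          exact absurd h2 hp'
        · exact ⟨[m, m + 1], by simpa using ⟨h3, h4⟩, m, rfl⟩
      · exact hs.elim
      · exact hs.elim
      · replace h0 := List.cons.inj h0
        obtain ⟨h0, rfl⟩ := h0
        rw [h] at hb
        simp [stRule, ← h0] at hb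
        obtain ⟨h1, h2, h3⟩ := hb
        have h4 : C.ext t 0 = C.ext i 0 := by
          rcases (ih i hi).child _ h1 with h | ⟨-, h⟩
          · exact h
          · exact absurd h hp'
        obtain ⟨-, h5⟩ := ((ih i hi).pick _ _ h2).resolve_left (by rw [h4]; exact era_ne hC hi)
        obtain ⟨⟨n, hn⟩, h6⟩ := (ih i hi).copy hp' _ _ _ h3
        refine ⟨[n], by simpa using hn, n, fun m hm => ?_, rfl⟩
        rw [← h4, ← h5] at hm
        exact hn.unique hC (h6 m hm)
  · intro hp u x x' h
    replace hp' := fun h => hp (hsub h)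
    replace h := mem_fact_succ hC h
    rcases h with h | h
    · exact (ih i hi).copy hp' u x x' h
    · have nd : ∀ l, ¬ ArithOut C t .copy l := fun l h => h.derived
      simp [StepOut, nd] at h
      rcases h with ⟨h, rfl, h0, rfl, rfl⟩ | ⟨h, rfl, h0, rfl, rfl⟩
      · rw [h] at hb
        simp [copyZeroRule, ← h0] at hb
        obtain ⟨h1, h2, h3⟩ := hb
        obtain ⟨ns, h4, rfl⟩ := (ih i hi).arith hp' .zero trivial _ h3
        have h5 : Hon C (C.ext i 2) (C.ext t 3) 0 := by simpa using h4
        refine ⟨⟨0, h5⟩, fun m hm => ?_⟩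
        obtain ⟨j, hj, h6⟩ := hm.exists_era
        rw [← h6] at h2
        rcases (ih j hj).zero _ h2 with h7 | h7
        · exact absurd (h7.trans h6) (hm.ne hC)
        · rwa [hm.unique hC h7]
      · rw [h] at hb
        simp [copySucRule, ← h0] at hb
        obtain ⟨h1, h2, h3⟩ := hb
        obtain ⟨⟨n, hn⟩, h4⟩ := (ih i hi).copy hp' _ _ _ h1
        obtain ⟨ns, h5, k, rfl⟩ := (ih i hi).arith hp' .suc trivial _ h3
        have h6 : Hon C (C.ext i 2) (C.ext t 3) k ∧ Hon C (C.ext i 2) (C.ext t 5) (k + 1) := by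
          simpa using h5
        refine ⟨⟨_, h6.2⟩, fun m hm => ?_⟩
        obtain ⟨j, hj, h7⟩ := hm.exists_era
        rw [← h7] at h2
        rcases (ih j hj).suc _ _ h2 with h8 | ⟨l, h8, h9⟩
        · exact absurd (h8.trans h7) (hm.ne hC)
        · rw [h7] at h8
          rw [hm.unique hC h9, (h4 l h8).unique hC h6.1]
          exact h6.2

theorem eraInv {R : ℕ → List ℕ → Bool} (hC : IsInfinite C) (hR : Decides c R)
    (hD : ∀ f ∈ D, factNullFree f) (t i : ℕ) (hi : (C.trig i).1 = eraRule) :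
    EraInv C R i (C.fact t) := by
  induction t generalizing i with
  | zero =>
    refine EraInv.of_fresh ?_
    rintro ⟨f, hf, hf'⟩
    rw [C.init] at hf
    obtain ⟨n, hn, -⟩ := (C.extOk i (Chase.lt_len hC i)).2.1 2 (hi ▸ existVar_eraRule_brake)
    exact hD f hf _ hf' n hn
  | succ t ih => exact EraInv.succ hC hR (fun i hi => ih i hi) hi

end

/-! ### No infinite fair derivation exists for positive instances -/

theorem finite_lists {α : Type*} {A : Set α} (hA : A.Finite) (n : ℕ) :
    {l : List α | l.length = n ∧ ∀ x ∈ l, x ∈ A}.Finite := by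
  have := hA.to_subtype
  refine ((List.finite_length_eq A n).image (List.map Subtype.val)).subset ?_
  rintro l ⟨hl, h⟩
  exact ⟨l.attachWith _ h, by simpa using hl, by simp⟩

theorem termsOf_finite {F : Set Fact} (hF : F.Finite) : (termsOf F).Finite := by
  refine (hF.biUnion fun f _ => f.2.finite_toSet).subset ?_
  rintro g ⟨f, hf, hg⟩
  exact Set.mem_biUnion hf hg

theorem outputOf_finite (t : Trigger) (σ : ℕ → GroundTerm) : (outputOf t σ).Finite := by
  refine (t.1.2.map (applyA σ)).finite_toSet.subset ?_
  rintro f ⟨b, hb, rfl⟩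
  exact List.mem_map_of_mem hb

namespace Chase

variable {S : RuleSet} {D : Set Fact} {C : Chase S D}

theorem fact_finite (hC : IsInfinite C) (hD : D.Finite) (i : ℕ) : (C.fact i).Finite := by
  induction i with
  | zero => rwa [C.init]
  | succ i ih =>
    rw [fact_succ hC]
    exact ih.union (outputOf_finite _ _)

theorem brake_lt (hC : IsInfinite C) {i j v : ℕ} (hv : existVar (C.trig i).1 v)
    (h : C.ext i v ∈ termsOf (C.fact j)) : i < j := by
  by_contra hij
  obtain ⟨f, hf, hf'⟩ := h
  exact ext_fresh hC hv ⟨f, C.fact_mono (not_lt.1 hij) hf, hf'⟩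

/-- Infinite derivations apply rules with existential variables infinitely often. -/
theorem infinite_existential (hC : IsInfinite C) (hD : D.Finite)
    (hconst : ∀ r ∈ S, ∀ b ∈ r.2, ∀ x ∈ b.2, ∃ v, x = Sum.inl v) :
    {t | ∃ v, existVar (C.trig t).1 v}.Infinite := by
  intro hfin
  obtain ⟨T, hT⟩ := hfin.bddAbove
  replace hT : ∀ t > T, ∀ v, ¬ existVar (C.trig t).1 v := fun t ht v hv =>
    absurd (hT ⟨v, hv⟩) (not_le.2 ht)
  set A := termsOf (C.fact (T + 1)) with hA
  have hAf : A.Finite := termsOf_finite (fact_finite hC hD _)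
  have hout : ∀ t > T, ∀ b ∈ (C.trig t).1.2, ∀ g ∈ (applyA (C.ext t) b).2,
      g ∈ termsOf (C.fact t) := by
    intro t ht b hb g hg
    obtain ⟨x, hx, rfl⟩ := List.mem_map.1 hg
    obtain ⟨v, rfl⟩ := hconst _ (trig_mem hC t) b hb x hx
    refine ext_body_mem hC ?_
    by_contra hv
    exact hT t ht v ⟨⟨b, hb, hx⟩, hv⟩
  have hterms : ∀ t, T < t → termsOf (C.fact t) ⊆ A := by
    intro t ht
    induction t, ht using Nat.le_induction with
    | base => exact subset_rfl
    | succ t ht ih =>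
      rintro g ⟨f, hf, hg⟩
      rw [fact_succ hC] at hf
      rcases hf with hf | ⟨b, hb, rfl⟩
      · exact ih ⟨f, hf, hg⟩
      · exact ih (hout t ht b hb g hg)
  have hnew : ∀ t, ∃ b ∈ (C.trig t).1.2, applyA (C.ext t) b ∉ C.fact t :=
    fun t => not_obsolete hC t fun _ _ => rfl
  choose b hb hb' using hnew
  have hinj : Function.Injective fun n => applyA (C.ext (T + 1 + n)) (b (T + 1 + n)) := by
    have key : ∀ m n, m < n → applyA (C.ext (T + 1 + m)) (b (T + 1 + m)) ≠
        applyA (C.ext (T + 1 + n)) (b (T + 1 + n)) := by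
      intro m n hmn e
      refine hb' (T + 1 + n) (e ▸ ?_)
      exact C.fact_mono (by omega) (head_mem hC (T + 1 + m) _ (hb _))
    intro m n e
    by_contra hmn
    rcases lt_or_gt_of_ne hmn with h | h
    · exact key m n h e
    · exact key n m h e.symm
  have hB : (⋃ r ∈ {r | r ∈ S}, ⋃ a ∈ {a | a ∈ r.2}, (Prod.mk a.1) ''
      {l : List GroundTerm | l.length = a.2.length ∧ ∀ x ∈ l, x ∈ A}).Finite :=
    S.finite_toSet.biUnion fun r _ => r.2.finite_toSet.biUnion fun a _ =>
      (finite_lists hAf _).image _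
  refine Set.infinite_of_injective_forall_mem hinj (fun n => ?_) hB
  refine Set.mem_biUnion (trig_mem hC (T + 1 + n)) (Set.mem_biUnion (hb (T + 1 + n)) ?_)
  refine ⟨_, ⟨?_, fun x hx => hterms _ (by omega) (hout (T + 1 + n) (by omega) _ (hb _) x hx)⟩, rfl⟩
  simp [applyA]

end Chase

/-- A form of König's lemma: an increasing relation with finitely many successors and finitely many
roots on an infinite set of natural numbers has an infinite path. -/
theorem exists_path {J : Set ℕ} (hJ : J.Infinite) (P : ℕ → ℕ → Prop)
    (hlt : ∀ i j, P i j → i < j) (hPJ : ∀ i j, P i j → i ∈ J)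
    (hfin : ∀ i, {j | P i j}.Finite) (hroot : {j ∈ J | ∀ i, ¬ P i j}.Finite) :
    ∃ p : ℕ → ℕ, ∀ k, P (p k) (p (k + 1)) := by
  let T : ℕ → Set ℕ := fun i => {j | Relation.ReflTransGen P i j}
  have hstep : ∀ i, (T i).Infinite → ∃ j, P i j ∧ (T j).Infinite := by
    intro i hi
    by_contra! h
    refine hi ((((hfin i).biUnion h).insert i).subset fun j hj => ?_)
    rcases Relation.ReflTransGen.cases_head hj with rfl | ⟨k, hk, hkj⟩
    · exact Set.mem_insert _ _
    · exact Set.mem_insert_of_mem _ (Set.mem_biUnion hk hkj)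
  have hstart : ∃ r, (T r).Infinite := by
    by_contra! h
    refine hJ ((hroot.biUnion fun r _ => h r).subset fun j hj => ?_)
    induction j using Nat.strong_induction_on with
    | _ j ih =>
      by_cases hr : ∃ i, P i j
      · obtain ⟨i, hi⟩ := hr
        obtain ⟨r, hr, hri⟩ := Set.mem_iUnion₂.1 (ih i (hlt i j hi) (hPJ i j hi))
        exact Set.mem_biUnion hr (Relation.ReflTransGen.tail hri hi)
      · exact Set.mem_biUnion (x := j) ⟨hj, not_exists.1 hr⟩ Relation.ReflTransGen.refl
  obtain ⟨r, hr⟩ := hstart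
  choose! g hg hg' using hstep
  have hinf : ∀ k, (T (g^[k] r)).Infinite := by
    intro k
    induction k with
    | zero => exact hr
    | succ k ih =>
      rw [Function.iterate_succ_apply']
      exact hg' _ ih
  refine ⟨fun k => g^[k] r, fun k => ?_⟩
  simp only [Function.iterate_succ_apply']
  exact hg _ (hinf k)

section

variable {c : Code} {a : ℕ} {D : Set Fact} {C : Chase (ruleSet c a) D}

theorem exists_pulled (hF : Fair C) {w : GroundTerm} {i : ℕ}
    (h : fct .brake [w] ∈ C.fact i) :
    ∃ j, ∀ b ∈ pullRule.2, applyA (fun _ => w) b ∈ C.fact j := by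
  obtain ⟨j, -, σ, hσ, hj⟩ := hF (pullRule, fun _ => w) (by simp [ruleSet]) i
    (by simpa [loaded, pullRule] using h)
  have h0 : σ 0 = w := hσ 0 (by simp [bodyVar, pullRule])
  refine ⟨j, fun b hb => ?_⟩
  convert hj b hb using 1
  simp only [pullRule, List.mem_cons, List.not_mem_nil, or_false] at hb
  rcases hb with rfl | rfl | rfl | rfl | rfl <;> simp [h0]

theorem existVar_ruleSet {r : Rule} (hr : r ∈ ruleSet c a) {v : ℕ} (hv : existVar r v) :
    r = genRule ∨ r = eraRule := by
  revert hv
  revert r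
  apply ruleSet_cases
  case hg => exact fun _ => .inl rfl
  case he => exact fun _ => .inr rfl
  case ha =>
    rintro r hr ⟨⟨b, hb, hbv⟩, h⟩
    exfalso
    simp only [ArithRule.toRule, List.mem_singleton] at hb
    subst hb
    obtain ⟨-, -, hw, hne⟩ := arithRules_wf c a r hr
    refine h ?_
    simp only [bodyVar, ArithRule.toRule, List.mem_map, exists_exists_and_eq_and, atomHasVar_atm,
      List.mem_cons] at hbv ⊢
    rcases hbv with rfl | ⟨x, hx, rfl⟩
    · obtain ⟨b, hb⟩ := List.exists_mem_of_ne_nil _ hne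
      exact ⟨b, hb, .inl rfl⟩
    · obtain ⟨b, hb, hxb⟩ := hw x hx
      exact ⟨b, hb, .inr ⟨x, hxb, rfl⟩⟩
  all_goals
    simp [existVar, bodyVar, pullRule, sucRule, copyZeroRule, copySucRule, stRule]
    try omega

/-- Only finitely many existential steps are overseen by a given brake. -/
theorem finite_overseen (hC : IsInfinite C) (hF : Fair C) (w : GroundTerm) :
    {t | (∃ v, existVar (C.trig t).1 v) ∧ C.ext t 0 = w}.Finite := by
  by_contra hinf
  have key : ∀ t, (∃ v, existVar (C.trig t).1 v) → C.ext t 0 = w →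
      fct .brake [w] ∈ C.fact t ∧ ¬ ∀ b ∈ pullRule.2, applyA (fun _ => w) b ∈ C.fact t := by
    rintro t ⟨v, hv⟩ rfl
    have hb := Chase.body_mem hC t
    rcases existVar_ruleSet (Chase.trig_mem hC t) hv with h | h
    · refine ⟨?_, gen_unpulled hC h⟩
      rw [h] at hb
      simpa using hb _ (.head _)
    · refine ⟨?_, era_unpulled hC h⟩
      rw [h] at hb
      simpa using hb _ (.head _)
  obtain ⟨t, ht, ht'⟩ := Set.Infinite.nonempty hinf
  obtain ⟨j, hj⟩ := exists_pulled hF (key t ht ht').1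
  refine hinf ((Set.finite_lt_nat j).subset fun s hs => ?_)
  by_contra hs'
  exact (key s hs.1 hs.2).2 fun b hb => C.fact_mono (not_lt.1 hs') (hj b hb)

theorem mem_brake (hC : IsInfinite C) {w : GroundTerm} {t : ℕ} (h : fct .brake [w] ∈ C.fact t) :
    fct .brake [w] ∈ D ∨ ∃ i, (C.trig i).1 = eraRule ∧ C.ext i 2 = w := by
  induction t with
  | zero => exact .inl (C.init ▸ h)
  | succ t ih =>
    replace h := mem_fact_succ hC h
    rcases h with h | h
    · exact ih h
    · have nd : ∀ l, ¬ ArithOut C t .brake l := fun l h => h.derived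
      simp [StepOut, nd] at h
      exact .inr ⟨t, h.1, h.2.symm⟩

theorem era_brake_mem (hC : IsInfinite C) {t : ℕ} (h : (C.trig t).1 = eraRule) :
    fct .brake [C.ext t 0] ∈ C.fact t := by
  have hb := Chase.body_mem hC t
  rw [h] at hb
  simpa using hb _ (.head _)

/-- There is an infinite chain of eras. -/
theorem exists_era_path (hC : IsInfinite C) (hF : Fair C) (hD : D.Finite) :
    ∃ p : ℕ → ℕ, (∀ k, (C.trig (p k)).1 = eraRule) ∧ ∀ k, C.ext (p (k + 1)) 0 = C.ext (p k) 2 := by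
  have hE : {t | ∃ v, existVar (C.trig t).1 v}.Infinite := by
    exact Chase.infinite_existential hC hD (ruleSet_head_vars c a)
  set W : Set GroundTerm := {w | fct .brake [w] ∈ D} with hW
  have hWf : W.Finite := by
    refine hD.preimage (f := fun w => fct .brake [w]) (Function.Injective.injOn ?_)
    intro w w' h
    simpa using h
  have hJ : {t | (C.trig t).1 = eraRule}.Infinite := by
    intro hfin
    refine hE (((hWf.union (hfin.image fun i => C.ext i 2)).biUnion fun w _ =>
      finite_overseen hC hF w).subset ?_)
    rintro t ⟨v, hv⟩
    have hb : fct .brake [C.ext t 0] ∈ C.fact t := by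
      have hb := Chase.body_mem hC t
      rcases existVar_ruleSet (Chase.trig_mem hC t) hv with h | h <;>
      · rw [h] at hb
        simpa using hb _ (.head _)
    refine Set.mem_biUnion (x := C.ext t 0) ?_ ⟨⟨v, hv⟩, rfl⟩
    rcases mem_brake hC hb with h | ⟨i, hi, h⟩
    · exact .inl h
    · exact .inr ⟨i, hi, h⟩
  have hex : ∀ t, (C.trig t).1 = eraRule → ∃ v, existVar (C.trig t).1 v := fun t ht =>
    ⟨2, ht ▸ existVar_eraRule_brake⟩
  obtain ⟨p, hp⟩ := exists_path hJ
    (fun i j => (C.trig i).1 = eraRule ∧ (C.trig j).1 = eraRule ∧ C.ext j 0 = C.ext i 2)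
    (fun i j ⟨hi, hj, h⟩ => Chase.brake_lt hC (hi ▸ existVar_eraRule_brake)
      ⟨_, era_brake_mem hC hj, by simp [h, fct]⟩)
    (fun i j h => h.1)
    (fun i => (finite_overseen hC hF (C.ext i 2)).subset fun j hj => ⟨hex j hj.2.1, hj.2.2⟩)
    ((hWf.biUnion fun w _ => finite_overseen hC hF w).subset fun j ⟨hj, h⟩ => by
      refine Set.mem_biUnion (x := C.ext j 0) ?_ ⟨hex j hj, rfl⟩
      rcases mem_brake hC (era_brake_mem hC hj) with h' | ⟨i, hi, h'⟩
      · exact h'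
      · exact absurd ⟨hi, hj, h'.symm⟩ (h i))
  exact ⟨p, fun k => (hp k).1, fun k => (hp k).2.2⟩

/-- The element picked by an era step on top of an era represents a candidate. -/
theorem era_pick {R : ℕ → List ℕ → Bool} (hC : IsInfinite C) (hR : Decides c R)
    (hD : ∀ f ∈ D, factNullFree f) {i t : ℕ} (hi : (C.trig i).1 = eraRule)
    (ht : (C.trig t).1 = eraRule) (h : C.ext t 0 = C.ext i 2) :
    ∃ n, ∃ k : List ℕ, Hon C (C.ext t 0) (C.ext t 1) (Encodable.encode (n :: k)) ∧
      Rejected R a (n :: k) ∧ Encodable.encode k ∈ eraState C i := by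
  have inv := eraInv hC hR hD t i hi
  have hp : fct .num [C.ext i 2, C.ext i 2] ∉ C.fact t := fun h' =>
    era_unpulled hC ht (h ▸ inv.pulled h')
  have hb := Chase.body_mem hC t
  rw [ht] at hb
  simp [eraRule, h] at hb
  obtain ⟨ns, h1, n, k, rfl, h2, h3⟩ := inv.arith hp .cand trivial _ hb.2.1
  exact ⟨n, k, by rw [h]; simpa using h1, h2, h3⟩

/-- An infinite fair derivation yields a function all of whose initial segments are rejected. -/
theorem exists_rejected {R : ℕ → List ℕ → Bool} (hC : IsInfinite C) (hF : Fair C)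
    (hR : Decides c R) (hD : ∀ f ∈ D, factNullFree f) (hDf : D.Finite) :
    ∃ f : ℕ → ℕ, ∀ k, R a ((List.range k).map f) = false := by
  obtain ⟨p, hp, hp'⟩ := exists_era_path hC hF hDf
  choose n l h1 h2 h3 using fun k => era_pick hC hR hD (hp k) (hp (k + 1)) (hp' k)
  have hl : ∀ k, l (k + 1) = n k :: l k := fun k =>
    Encodable.encode_injective (h3 (k + 1) _ (h1 k))
  set L : ℕ → List ℕ := fun k => (l k).reverse with hL
  have hL' : ∀ k, L (k + 1) = L k ++ [n k] := fun k => by simp [hL, hl]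
  have hlen : ∀ k, k ≤ (L k).length := by
    intro k
    induction k with
    | zero => simp
    | succ k ih => simp [hL', ih]
  have hpre : ∀ j k, j ≤ k → L j <+: L k := by
    intro j k hjk
    induction k, hjk using Nat.le_induction with
    | base => exact List.prefix_rfl
    | succ k _ ih => exact ih.trans (hL' k ▸ List.prefix_append _ _)
  refine ⟨fun j => (L (j + 1)).getD j 0, fun k => ?_⟩
  have he : (List.range k).map (fun j => (L (j + 1)).getD j 0) = (L k).take k := by
    refine List.ext_getElem (by simp [hlen k]) fun j hj hj' => ?_
    have hjk : j < k := by simpa using hj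
    have hj1 : j < (L (j + 1)).length := hlen (j + 1)
    simp [List.getElem?_eq_getElem hj1, (hpre (j + 1) k hjk).getElem hj1]
  rw [he]
  have := h2 k ((L k).take k).reverse (by
    refine ⟨n k :: ((L k).drop k).reverse, ?_⟩
    rw [List.cons_append, ← List.reverse_append, List.take_append_drop]
    simp [hL])
  simpa using this

end

/-! ### Building derivations -/

theorem exists_properExt (t : Trigger) {F : Set Fact} (hF : F.Finite) :
    ∃ σ, properExt t F σ := by
  classical
  have hfin : {n : ℕ | (Sum.inr n : GroundTerm) ∈ termsOf F}.Finite :=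
    (termsOf_finite hF).preimage Sum.inr_injective.injOn
  obtain ⟨N, hN⟩ := hfin.bddAbove
  refine ⟨fun v => if bodyVar t.1 v then t.2 v else Sum.inr (N + 1 + v), fun v hv => if_pos hv,
    fun v hv => ⟨N + 1 + v, if_neg hv.2, fun h => ?_⟩, fun v w hv hw h => ?_⟩
  · have := hN h
    omega
  · simpa [hv.2, hw.2] using h

theorem loaded_mono {t : Trigger} {F G : Set Fact} (h : F ⊆ G) (hl : loaded t F) : loaded t G :=
  fun b hb => h (hl b hb)

theorem ChaseStep.subset {S : RuleSet} {F G : Set Fact} (h : ChaseStep S F G) : F ⊆ G := by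
  obtain ⟨t, -, σ, -, rfl⟩ := h
  exact Set.subset_union_left

theorem ChaseStep.finite {S : RuleSet} {F G : Set Fact} (h : ChaseStep S F G) (hF : F.Finite) :
    G.Finite := by
  obtain ⟨t, -, σ, -, rfl⟩ := h
  exact hF.union (outputOf_finite t σ)

/-- The era `w` has no next era in `F`. -/
def Childless (w : GroundTerm) (F : Set Fact) : Prop := ∀ u, fct .child [w, u] ∉ F

/-- `G` is reached from `F` without creating a next era of `w`. -/
def Reach (S : RuleSet) (w : GroundTerm) : Set Fact → Set Fact → Prop :=
  Relation.ReflTransGen fun F G => ChaseStep S F G ∧ Childless w G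

namespace Reach

variable {S : RuleSet} {w : GroundTerm} {F G : Set Fact}

theorem subset (h : Reach S w F G) : F ⊆ G := by
  induction h with
  | refl => exact subset_rfl
  | tail _ h ih => exact ih.trans h.1.subset

theorem finite (h : Reach S w F G) (hF : F.Finite) : G.Finite := by
  induction h with
  | refl => exact hF
  | tail _ h ih => exact h.1.finite ih

theorem childless (h : Reach S w F G) (hF : Childless w F) : Childless w G := by
  induction h with
  | refl => exact hF
  | tail _ h ih => exact h.2

theorem trans {H : Set Fact} (h : Reach S w F G) (h' : Reach S w G H) : Reach S w F H :=
  Relation.ReflTransGen.trans h h'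

theorem steps (h : Reach S w F G) : Relation.ReflTransGen (ChaseStep S) F G :=
  Relation.ReflTransGen.mono (fun _ _ h => h.1) _ _ h

/-- Loaded triggers whose rule does not create eras can be made obsolete. -/
theorem fire {r : Rule} (hr : r ∈ S) (hne : ∀ b ∈ r.2, b.1 ≠ PSym.child.code) (hF : F.Finite)
    (hw : Childless w F) {σ : ℕ → GroundTerm} (hl : loaded (r, σ) F) :
    ∃ G, Reach S w F G ∧ ∃ σ', (∀ v, bodyVar r v → σ' v = σ v) ∧ ∀ b ∈ r.2, applyA σ' b ∈ G := by
  by_cases ho : obsolete (r, σ) F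
  · exact ⟨F, .refl, ho⟩
  obtain ⟨τ, hτ⟩ := exists_properExt (r, σ) hF
  refine ⟨F ∪ outputOf (r, σ) τ, .single ⟨⟨_, ⟨hr, hl, ho⟩, τ, hτ, rfl⟩, ?_⟩, τ, hτ.1,
    fun b hb => Or.inr ⟨b, hb, rfl⟩⟩
  rintro u (hu | ⟨b, hb, hu⟩)
  · exact hw u hu
  · exact hne b hb (congrArg Prod.fst hu).symm

end Reach

/-- Starting anywhere after `F`, the fact `p` can be reached without creating a next era of
`w`. -/
def Evt (S : RuleSet) (w : GroundTerm) (F : Set Fact) (p : Fact) : Prop :=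
  ∀ G, Reach S w F G → ∃ G', Reach S w G G' ∧ p ∈ G'

namespace Evt

variable {S : RuleSet} {w : GroundTerm} {F : Set Fact}

theorem of_mem {p : Fact} (h : p ∈ F) : Evt S w F p := fun G hG => ⟨G, .refl, hG.subset h⟩

theorem forall_mem {l : List Fact} (h : ∀ p ∈ l, Evt S w F p) {G : Set Fact}
    (hG : Reach S w F G) : ∃ G', Reach S w G G' ∧ ∀ p ∈ l, p ∈ G' := by
  induction l with
  | nil => exact ⟨G, .refl, by simp⟩
  | cons p l ih =>
    rw [List.forall_mem_cons] at h
    obtain ⟨G1, h1, h2⟩ := ih h.2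
    obtain ⟨G2, h3, h4⟩ := h.1 G1 (hG.trans h1)
    refine ⟨G2, h1.trans h3, ?_⟩
    rw [List.forall_mem_cons]
    exact ⟨h4, fun q hq => h3.subset (h2 q hq)⟩

/-- Rules that neither create eras nor have existential variables. -/
theorem fire {r : Rule} (hr : r ∈ S) (hne : ∀ b ∈ r.2, b.1 ≠ PSym.child.code)
    (hv : ∀ v, ¬ existVar r v) (hconst : ∀ b ∈ r.2, ∀ x ∈ b.2, ∃ v, x = Sum.inl v)
    (hF : F.Finite) (hw : Childless w F) (σ : ℕ → GroundTerm)
    (hl : ∀ b ∈ r.1, Evt S w F (applyA σ b)) : ∀ b ∈ r.2, Evt S w F (applyA σ b) := by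
  intro b hb G hG
  obtain ⟨G1, h1, h2⟩ := Evt.forall_mem (l := r.1.map (applyA σ)) (List.forall_mem_map.2 hl) hG
  obtain ⟨G2, h3, σ', h4, h5⟩ := Reach.fire (σ := σ) hr hne ((hG.trans h1).finite hF)
    ((hG.trans h1).childless hw) (fun b hb => h2 _ (List.mem_map_of_mem hb))
  refine ⟨G2, h1.trans h3, ?_⟩
  convert h5 b hb using 1
  refine Prod.ext rfl (List.map_congr_left fun x hx => ?_)
  obtain ⟨v, rfl⟩ := hconst b hb x hx
  refine (h4 v ?_).symm
  by_contra h
  exact hv v ⟨⟨b, hb, hx⟩, h⟩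

end Evt

/-! ### Arithmetic within an era -/

theorem evt_rule {c : Code} {a : ℕ} {w : GroundTerm} {F : Set Fact} (hF : F.Finite)
    (hw : Childless w F) {r : Rule} (hr : r ∈ ruleSet c a)
    (hne : ∀ b ∈ r.2, b.1 ≠ PSym.child.code ∧ b.1 ≠ PSym.grow.code) (σ : ℕ → GroundTerm)
    (hl : ∀ b ∈ r.1, Evt (ruleSet c a) w F (applyA σ b)) :
    ∀ b ∈ r.2, Evt (ruleSet c a) w F (applyA σ b) := by
  refine Evt.fire hr (fun b hb => (hne b hb).1) (fun v hv => ?_) (ruleSet_head_vars c a r hr) hF hw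
    σ hl
  rcases existVar_ruleSet hr hv with rfl | rfl
  · exact (hne _ (.head _)).2 rfl
  · exact (hne (atm .child [0, 2]) (by simp [eraRule])).1 rfl

/-- In `F`, the numbers `0, …, n` of the era `w` are `h 0, …, h n`. -/
structure Numbers (F : Set Fact) (w : GroundTerm) (h : ℕ → GroundTerm) (n : ℕ) : Prop where
  zero : fct .zero [w, h 0] ∈ F
  num : ∀ i ≤ n, fct .num [w, h i] ∈ F
  suc : ∀ i < n, fct .suc [w, h i, h (i + 1)] ∈ F
  grow : ∀ i ≤ n, fct .grow [w, h i, w] ∈ F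
  pick : ∀ i ≤ n, fct .pick [w, h i, w] ∈ F

theorem Numbers.mono {F G : Set Fact} {w : GroundTerm} {h : ℕ → GroundTerm} {n : ℕ}
    (hn : Numbers F w h n) (hFG : F ⊆ G) : Numbers G w h n :=
  ⟨hFG hn.zero, fun i hi => hFG (hn.num i hi), fun i hi => hFG (hn.suc i hi),
    fun i hi => hFG (hn.grow i hi), fun i hi => hFG (hn.pick i hi)⟩

theorem exists_numbers {c : Code} {a : ℕ} {w z : GroundTerm} {F : Set Fact} (hF : F.Finite)
    (hw : Childless w F) (hb : fct .brake [w] ∈ F) (h0 : fct .zero [w, z] ∈ F)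
    (h1 : fct .num [w, z] ∈ F) (h2 : fct .grow [w, z, w] ∈ F) (h3 : fct .pick [w, z, w] ∈ F)
    (n : ℕ) : ∃ G, Reach (ruleSet c a) w F G ∧ ∃ h, Numbers G w h n := by
  induction n with
  | zero => exact ⟨F, .refl, fun _ => z, h0, by simpa, by simp, by simpa, by simpa⟩
  | succ n ih =>
    obtain ⟨G, hG, h, hh⟩ := ih
    obtain ⟨G1, hG1, σ, hσ, hm⟩ := Reach.fire (S := ruleSet c a) (r := genRule)
      (σ := fun v => if v = 0 then w else h n) (by simp [ruleSet])
      (by simp [genRule, atm, PSym.code]) (hG.finite hF) (hG.childless hw)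
      (by simp [loaded, genRule, hG.subset hb, hh.num, hh.grow])
    have hσ0 : σ 0 = w := hσ 0 (by simp [bodyVar, genRule])
    have hσ1 : σ 1 = h n := hσ 1 (by simp [bodyVar, genRule])
    simp only [genRule, List.forall_mem_cons, applyA_atm, List.map_cons, List.map_nil, hσ0, hσ1,
      List.not_mem_nil, false_imp_iff, implies_true, and_true] at hm
    obtain ⟨g1, g2, g3, g4⟩ := hm
    have hG' := hG.trans hG1
    have hs := evt_rule (c := c) (a := a) (hG'.finite hF) (hG'.childless hw) (r := sucRule)
      (by simp [ruleSet]) (by simp [sucRule, atm, PSym.code])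
      (fun v => if v = 0 then w else if v = 1 then h n else σ 2)
      (by simpa [sucRule] using ⟨Evt.of_mem g1, Evt.of_mem g2⟩)
    simp only [sucRule, List.forall_mem_cons, applyA_atm, List.map_cons, List.map_nil,
      List.not_mem_nil, false_imp_iff, implies_true, and_true, if_true, one_ne_zero, if_false,
      OfNat.ofNat_ne_zero, OfNat.ofNat_ne_one] at hs
    obtain ⟨G2, hG2, g5⟩ := hs G1 .refl
    refine ⟨G2, hG'.trans hG2, fun i => if i ≤ n then h i else σ 2, ?_⟩
    have hh2 := hh.mono (hG1.trans hG2).subset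
    refine ⟨by simpa using hh2.zero, fun i hi => ?_, fun i hi => ?_, fun i hi => ?_,
      fun i hi => ?_⟩
    · rcases Nat.le_succ_iff.1 hi with hi | rfl
      · simpa [hi] using hh2.num i hi
      · simpa using hG2.subset g2
    · rcases Nat.lt_succ_iff_lt_or_eq.1 hi with hi | rfl
      · simpa [hi.le, Nat.succ_le_of_lt hi] using hh2.suc i hi
      · simpa using g5
    · rcases Nat.le_succ_iff.1 hi with hi | rfl
      · simpa [hi] using hh2.grow i hi
      · simpa using hG2.subset g3
    · rcases Nat.le_succ_iff.1 hi with hi | rfl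
      · simpa [hi] using hh2.pick i hi
      · simpa using hG2.subset g4

open Filter in
theorem Der.evt {c : Code} {a e : ℕ} {s : PSym} {l : List ℕ} (hd : Der (arithRules c a) e s l) :
    ∀ᶠ n in atTop, ∀ {w : GroundTerm} {F : Set Fact} {h : ℕ → GroundTerm}, F.Finite →
      Childless w F → Numbers F w h n → Evt (ruleSet c a) w F (fct .st [w, h e]) →
      Evt (ruleSet c a) w F (fct s (w :: l.map h)) := by
  induction hd with
  | num i => exact (eventually_ge_atTop i).mono fun n hn w F h _ _ hh _ => .of_mem (hh.num i hn)
  | zero => exact .of_forall fun n w F h _ _ hh _ => .of_mem hh.zero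
  | suc i => exact (eventually_gt_atTop i).mono fun n hn w F h _ _ hh _ => .of_mem (hh.suc i hn)
  | st => exact .of_forall fun n w F h _ _ _ hs => hs
  | rule r hr v _ ih =>
    have ih' := (eventually_all_finite r.1.finite_toSet).2 ih
    refine ih'.mono fun n hn w F h hF hw hh hs => ?_
    have hR : r.toRule ∈ ruleSet c a := by
      simp only [ruleSet, List.mem_cons, List.mem_map]
      exact .inr <| .inr <| .inr <| .inr <| .inr <| .inr <| .inr ⟨r, hr, rfl⟩
    have hσ : ∀ b : PSym × List ℕ,
        applyA (fun i => if i = 0 then w else h (v (i - 1))) (atm b.1 (0 :: b.2.map (· + 1))) =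
          fct b.1 (w :: (b.2.map v).map h) := by
      intro b
      simp [Function.comp_def]
    have hD : r.2.1.Derived := (arithRules_wf c a r hr).1
    have := evt_rule hF hw hR (by
      simp only [ArithRule.toRule, List.mem_singleton, forall_eq, atm, ne_eq,
        PSym.code_injective.eq_iff]
      constructor <;> intro h <;> simp [h, PSym.Derived] at hD)
      (fun i => if i = 0 then w else h (v (i - 1))) (by
        simp only [ArithRule.toRule, List.forall_mem_map]
        intro b hb
        rw [hσ]
        exact hn b hb hF hw hh hs)
    simp only [ArithRule.toRule, List.mem_singleton, forall_eq] at this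
    rwa [hσ] at this

/-- The state of an era is the number picked in the parent era. -/
theorem evt_st {c : Code} {a e n : ℕ} {w w₀ : GroundTerm} {h h₀ : ℕ → GroundTerm} {F : Set Fact}
    (hF : F.Finite) (hw : Childless w F) (hh : Numbers F w h n) (hn : e ≤ n)
    (hc : fct .child [w₀, w] ∈ F) (hz : fct .zero [w₀, h₀ 0] ∈ F)
    (hs : ∀ i < e, fct .suc [w₀, h₀ i, h₀ (i + 1)] ∈ F) (hp : fct .pick [w₀, h₀ e, w] ∈ F) :
    Evt (ruleSet c a) w F (fct .st [w, h e]) := by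
  have key : ∀ i ≤ e, Evt (ruleSet c a) w F (fct .copy [w₀, w, h₀ i, h i]) := by
    intro i
    induction i with
    | zero =>
      intro _
      have := evt_rule (c := c) (a := a) hF hw (r := copyZeroRule) (by simp [ruleSet])
        (by simp [copyZeroRule, atm, PSym.code]) (fun v => [w₀, w, h₀ 0, h 0].getD v w)
        (by simpa [copyZeroRule] using ⟨Evt.of_mem hc, Evt.of_mem hz, Evt.of_mem hh.zero⟩)
      simpa [copyZeroRule] using this
    | succ i ih =>
      intro hi
      have := evt_rule (c := c) (a := a) hF hw (r := copySucRule) (by simp [ruleSet])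
        (by simp [copySucRule, atm, PSym.code])
        (fun v => [w₀, w, h₀ i, h i, h₀ (i + 1), h (i + 1)].getD v w)
        (by simpa [copySucRule] using ⟨ih (by omega), Evt.of_mem (hs i (by omega)),
          Evt.of_mem (hh.suc i (by omega))⟩)
      simpa [copySucRule] using this
  have := evt_rule (c := c) (a := a) hF hw (r := stRule) (by simp [ruleSet])
    (by simp [stRule, atm, PSym.code]) (fun v => [w₀, w, h₀ e, h e].getD v w)
    (by simpa [stRule] using ⟨Evt.of_mem hc, Evt.of_mem hp, key e le_rfl⟩)
  simpa [stRule] using this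

open Encodable (encode decode)

/-! ### An infinite fair derivation exists for negative instances -/

/-- `w` is an era without next era, and its state is the number `e`. -/
structure LastEra (F : Set Fact) (w : GroundTerm) (e : ℕ) : Prop where
  finite : F.Finite
  childless : Childless w F
  brake : fct .brake [w] ∈ F
  start : ∃ z, fct .zero [w, z] ∈ F ∧ fct .num [w, z] ∈ F ∧ fct .grow [w, z, w] ∈ F ∧
    fct .pick [w, z, w] ∈ F
  parent : ∃ (w₀ : GroundTerm) (h : ℕ → GroundTerm), fct .child [w₀, w] ∈ F ∧
    fct .zero [w₀, h 0] ∈ F ∧ (∀ i < e, fct .suc [w₀, h i, h (i + 1)] ∈ F) ∧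
    fct .pick [w₀, h e, w] ∈ F

theorem mem_termsOf {s : PSym} {l : List GroundTerm} {F : Set Fact} (h : fct s l ∈ F)
    {g : GroundTerm} (hg : g ∈ l) : g ∈ termsOf F :=
  ⟨_, h, hg⟩

/-- An era with a candidate can be followed by another era. -/
theorem LastEra.next {c : Code} {a : ℕ} {R : ℕ → List ℕ → Bool} (hR : Decides c R) {F : Set Fact}
    {w : GroundTerm} {n : ℕ} {k : List ℕ} (hk : Rejected R a (n :: k))
    (hF : LastEra F w (encode k)) :
    ∃ F' w', Relation.TransGen (ChaseStep (ruleSet c a)) F F' ∧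
      LastEra F' w' (encode (n :: k)) ∧ w' ∉ termsOf F := by
  obtain ⟨z, z1, z2, z3, z4⟩ := hF.start
  obtain ⟨w₀, h₀, p1, p2, p3, p4⟩ := hF.parent
  obtain ⟨m, hm, hm1, hm2⟩ := ((Der.cand hR a n k hk).evt.and
    ((Filter.eventually_ge_atTop (encode k)).and
      (Filter.eventually_ge_atTop (encode (n :: k))))).exists
  obtain ⟨G, hG, h, hh⟩ := exists_numbers (c := c) (a := a) hF.finite hF.childless hF.brake z1 z2
    z3 z4 m
  have hGf := hG.finite hF.finite
  have hGw := hG.childless hF.childless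
  have hst : Evt (ruleSet c a) w G (fct .st [w, h (encode k)]) :=
    evt_st hGf hGw hh hm1 (hG.subset p1) (hG.subset p2) (fun i hi => hG.subset (p3 i hi))
      (hG.subset p4)
  obtain ⟨G1, hG1, hcand⟩ := hm hGf hGw hh hst G .refl
  replace hh := hh.mono hG1.subset
  have hGG := hG.trans hG1
  set e := encode (n :: k) with he
  let t : Trigger := (eraRule, fun v => if v = 0 then w else h e)
  have hact : Active (ruleSet c a) G1 t := by
    refine ⟨by simp [ruleSet, t], ?_, ?_⟩
    · have h1 := hGG.subset hF.brake
      have h2 := hh.pick e hm2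
      simp only [List.map_cons, List.map_nil] at hcand
      simp [loaded, t, eraRule, h1, h2, hcand]
    · rintro ⟨σ, hσ, ho⟩
      have hσ0 : σ 0 = w := hσ 0 (by simp [bodyVar, t, eraRule])
      have := ho (atm .child [0, 2]) (by simp [t, eraRule])
      simp only [applyA_atm, List.map_cons, List.map_nil, hσ0] at this
      exact hGG.childless hF.childless _ this
  obtain ⟨σ, hσ⟩ := exists_properExt t (hGG.finite hF.finite)
  have hσ0 : σ 0 = w := hσ.1 0 (by simp [bodyVar, t, eraRule])
  have hσ1 : σ 1 = h e := hσ.1 1 (by simp [bodyVar, t, eraRule])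
  have hfr : σ 2 ∉ termsOf G1 := by
    obtain ⟨u, hu, h⟩ := hσ.2.1 2 (by simp [existVar, bodyVar, t, eraRule])
    rwa [hu]
  have hmem : ∀ b ∈ eraRule.2, applyA σ b ∈ G1 ∪ outputOf t σ := fun b hb => .inr ⟨b, hb, rfl⟩
  simp only [eraRule, List.forall_mem_cons, applyA_atm, List.map_cons, List.map_nil, hσ0, hσ1,
    List.not_mem_nil, false_imp_iff, implies_true, and_true] at hmem
  obtain ⟨e1, e2, e3, e4, e5, e6, e7⟩ := hmem
  refine ⟨G1 ∪ outputOf t σ, σ 2, .tail' hGG.steps ⟨t, hact, σ, hσ, rfl⟩, ⟨?_, ?_, e3,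
    ⟨_, e4, e5, e6, e7⟩, w, h, e2, .inl hh.zero, fun i hi => .inl (hh.suc i (hi.trans_le hm2)),
    e1⟩, fun hx => ?_⟩
  · exact (hGG.finite hF.finite).union (outputOf_finite _ _)
  · rintro u (hu | ⟨b, hb, hu⟩)
    · exact hfr (mem_termsOf hu (by simp))
    · have hne : σ 2 ≠ w := fun h' => hfr (mem_termsOf hh.zero (by simp [h']))
      simp only [t, eraRule, List.mem_cons, List.not_mem_nil, or_false] at hb
      rcases hb with rfl | rfl | rfl | rfl | rfl | rfl | rfl <;> simp [hσ0, hne] at hu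
  · obtain ⟨f, hf, hg⟩ := hx
    exact hfr ⟨f, hGG.subset hf, hg⟩

theorem LastEra.mono {F G : Set Fact} {w : GroundTerm} {e : ℕ} (h : LastEra F w e) (hFG : F ⊆ G)
    (hG : G.Finite) (hw : Childless w G) : LastEra G w e := by
  obtain ⟨z, z1, z2, z3, z4⟩ := h.start
  obtain ⟨w₀, h₀, p1, p2, p3, p4⟩ := h.parent
  exact ⟨hG, hw, hFG h.brake, ⟨z, hFG z1, hFG z2, hFG z3, hFG z4⟩,
    w₀, h₀, hFG p1, hFG p2, fun i hi => hFG (p3 i hi), hFG p4⟩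

theorem child_head (c : Code) (a : ℕ) : ∀ r ∈ ruleSet c a, ∀ b ∈ r.2, b.1 = PSym.child.code →
    bodyVar r 0 ∧ ∃ v, b = atm .child [0, v] := by
  apply ruleSet_cases
  case ha =>
    intro r hr b hb h
    have hD : r.2.1.Derived := (arithRules_wf c a r hr).1
    rw [ArithRule.toRule, List.mem_singleton] at hb
    subst hb
    have := PSym.code_injective h
    simp [this, PSym.Derived] at hD
  all_goals
    simp [genRule, pullRule, eraRule, sucRule, copyZeroRule, copySucRule, stRule, atm, PSym.code,
      bodyVar, atomHasVar]

/-- The first term of a new fact for `child` occurs in the support. -/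
theorem child_mem_support {c : Code} {a : ℕ} {t : Trigger} (ht : t.1 ∈ ruleSet c a)
    {σ : ℕ → GroundTerm} (hσ : agreesOnBody t σ) {w u : GroundTerm}
    (h : fct .child [w, u] ∈ outputOf t σ) : w ∈ termsOf (support t) := by
  obtain ⟨b, hb, hw⟩ := h
  obtain ⟨h0, v, rfl⟩ := child_head c a t.1 ht b hb (congrArg Prod.fst hw).symm
  simp only [applyA_atm, List.map_cons, List.map_nil, fct_inj, true_and, List.cons.injEq] at hw
  rw [hw.1, hσ 0 h0]
  obtain ⟨b', hb', hv⟩ := h0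
  exact ⟨_, ⟨b', hb', rfl⟩, List.mem_map.2 ⟨_, hv, rfl⟩⟩

theorem subset_of_transGen {S : RuleSet} {F G : Set Fact}
    (h : Relation.TransGen (ChaseStep S) F G) : F ⊆ G := by
  induction h with
  | single h => exact h.subset
  | tail _ h ih => exact ih.trans h.subset

/-- The next era can be started such that a given trigger becomes obsolete. -/
theorem LastEra.next_obsolete {c : Code} {a : ℕ} {R : ℕ → List ℕ → Bool} (hR : Decides c R)
    {F : Set Fact} {w : GroundTerm} {n : ℕ} {k : List ℕ} (hk : Rejected R a (n :: k))
    (hF : LastEra F w (encode k)) (t : Trigger) :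
    ∃ F' w', Relation.TransGen (ChaseStep (ruleSet c a)) F F' ∧
      LastEra F' w' (encode (n :: k)) ∧ (t.1 ∈ ruleSet c a → loaded t F → obsolete t F') := by
  obtain ⟨G, w', hG, hw, hfr⟩ := hF.next hR hk
  have hFG := subset_of_transGen hG
  by_cases h : t.1 ∈ ruleSet c a ∧ loaded t F ∧ ¬ obsolete t G
  · obtain ⟨h1, h2, h3⟩ := h
    obtain ⟨σ, hσ⟩ := exists_properExt t hw.finite
    have hs : ChaseStep (ruleSet c a) G (G ∪ outputOf t σ) :=
      ⟨t, ⟨h1, loaded_mono hFG h2, h3⟩, σ, hσ, rfl⟩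
    refine ⟨_, w', hG.tail hs, hw.mono hs.subset (hs.finite hw.finite) ?_, fun _ _ =>
      ⟨σ, hσ.1, fun b hb => .inr ⟨b, hb, rfl⟩⟩⟩
    rintro u (hu | hu)
    · exact hw.childless u hu
    · obtain ⟨_, ⟨b, hb, rfl⟩, hg⟩ := child_mem_support h1 hσ.1 hu
      exact hfr ⟨_, h2 b hb, hg⟩
  · exact ⟨G, w', hG, hw, fun h1 h2 => by_contra fun h3 => h ⟨h1, h2, h3⟩⟩

/-- Paths between the members of a sequence can be joined to a single sequence. -/
theorem exists_joined_path {α : Type*} {r : α → α → Prop} {F : ℕ → α}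
    (h : ∀ k, Relation.TransGen r (F k) (F (k + 1))) :
    ∃ g : ℕ → α, g 0 = F 0 ∧ (∀ i, r (g i) (g (i + 1))) ∧ ∀ k, ∃ i ≥ k, g i = F k := by
  have path : ∀ {x y : α}, Relation.TransGen r x y →
      ∃ (n : ℕ) (p : ℕ → α), p 0 = x ∧ r (p n) y ∧ ∀ i < n, r (p i) (p (i + 1)) := by
    intro x y hxy
    induction hxy with
    | single hxy => exact ⟨0, fun _ => x, rfl, hxy, by simp⟩
    | @tail y z _ hyz ih =>
      obtain ⟨n, p, h0, hn, hp⟩ := ih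
      refine ⟨n + 1, fun i => if i ≤ n then p i else y, by simpa using h0, by simpa using hyz,
        fun i hi => ?_⟩
      rcases Nat.lt_succ_iff_lt_or_eq.1 hi with hi | rfl
      · simpa [hi.le, Nat.succ_le_of_lt hi] using hp i hi
      · simpa using hn
  choose n p h0 hn hp using fun k => path (h k)
  let next : ℕ × ℕ → ℕ × ℕ := fun x => if x.2 < n x.1 then (x.1, x.2 + 1) else (x.1 + 1, 0)
  let s : ℕ → ℕ × ℕ := fun i => next^[i] (0, 0)
  have hs : ∀ i, s (i + 1) = next (s i) := fun i => Function.iterate_succ_apply' next i _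
  have hle : ∀ i, (s i).2 ≤ n (s i).1 := by
    intro i
    induction i with
    | zero => exact Nat.zero_le _
    | succ i ih =>
      rw [hs]
      by_cases hi : (s i).2 < n (s i).1
      · simp only [next, if_pos hi]
        exact hi
      · simp [next, if_neg hi]
  have hvisit : ∀ k, ∃ i ≥ k, s i = (k, 0) := by
    intro k
    induction k with
    | zero => exact ⟨0, le_rfl, rfl⟩
    | succ k ih =>
      obtain ⟨i, hi, hik⟩ := ih
      have hj : ∀ j ≤ n k, s (i + j) = (k, j) := by
        intro j
        induction j with
        | zero => exact fun _ => hik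
        | succ j ihj =>
          intro hj
          rw [← add_assoc, hs, ihj (by omega)]
          exact if_pos hj
      refine ⟨i + n k + 1, by omega, ?_⟩
      rw [hs, hj _ le_rfl]
      exact if_neg (lt_irrefl _)
  refine ⟨fun i => p (s i).1 (s i).2, h0 0, fun i => ?_, fun k => ?_⟩
  · simp only [hs]
    by_cases hi : (s i).2 < n (s i).1
    · simp only [next, if_pos hi]
      exact hp _ _ hi
    · simp only [next, if_neg hi]
      rw [h0, le_antisymm (hle i) (not_lt.1 hi)]
      exact hn _
  · obtain ⟨i, hi, hik⟩ := hvisit k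
    exact ⟨i, hi, by simp [hik, h0]⟩

theorem instOf_agree {t t' : Trigger} (h : instOf t = instOf t') {v : ℕ} (hv : bodyVar t.1 v) :
    t.2 v = t'.2 v := by
  obtain ⟨r, σ⟩ := t
  obtain ⟨r', σ'⟩ := t'
  obtain ⟨rfl, h⟩ := Prod.mk.inj h
  obtain ⟨b, hb, hv⟩ := hv
  have := congrArg Prod.snd (List.map_inj_left.1 h b hb)
  exact List.map_inj_left.1 this _ hv

theorem loaded_congr {t t' : Trigger} (h : instOf t = instOf t') {F : Set Fact}
    (hl : loaded t F) : loaded t' F := by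
  obtain ⟨r, σ⟩ := t
  obtain ⟨r', σ'⟩ := t'
  obtain ⟨rfl, h⟩ := Prod.mk.inj h
  intro b hb
  rw [← List.map_inj_left.1 h b hb]
  exact hl b hb

theorem obsolete_congr {t t' : Trigger} (h : instOf t = instOf t') {F : Set Fact}
    (ho : obsolete t F) : obsolete t' F := by
  obtain ⟨τ, h1, h2⟩ := ho
  have hr : t.1 = t'.1 := (Prod.mk.inj h).1
  refine ⟨τ, fun v hv => ?_, hr ▸ h2⟩
  rw [← hr] at hv
  rw [h1 v hv, instOf_agree h hv]

/-- A sequence of derivations that handles triggers one by one yields a fair derivation. -/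
theorem exists_fair_chase {S : RuleSet} {F : ℕ → Set Fact}
    (hF : ∀ k, Relation.TransGen (ChaseStep S) (F k) (F (k + 1)))
    (hfair : ∀ k, ∀ p ∈ (decode (Nat.unpair k).2 : Option (Rule × List Fact)), ∀ t : Trigger,
      instOf t = p → t.1 ∈ S → loaded t (F k) → obsolete t (F (k + 1))) :
    ∃ C : Chase S (F 0), IsInfinite C ∧ Fair C := by
  obtain ⟨g, hg0, hg, hgF⟩ := exists_joined_path hF
  choose t ht σ hσ hs using hg
  refine ⟨⟨⊤, g, t, σ, hg0, fun i _ => ht i, fun i _ => hσ i, fun i _ => hs i,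
    fun i hi => absurd (ENat.natCast_lt_top i) hi⟩, rfl, fun t htS i hl => ?_⟩
  have hmono : Monotone g := monotone_nat_of_le_succ fun i => by
    rw [hs]
    exact Set.subset_union_left
  set k := Nat.pair i (encode (instOf t)) with hk
  obtain ⟨m, hm, hmk⟩ := hgF k
  obtain ⟨m', hm', hmk'⟩ := hgF (k + 1)
  have hik : i ≤ k := Nat.left_le_pair _ _
  refine ⟨m', by omega, ?_⟩
  have := hfair k (instOf t) (by rw [hk, Nat.unpair_pair]; exact Encodable.encodek _) t rfl htS
    (hmk ▸ loaded_mono (hmono (hik.trans hm)) hl)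
  rwa [← hmk'] at this

/-- The initial database: an era `2` with number zero `3`, whose parent era is `0` with number
zero `1`. -/
def startDatabase : Database :=
  [fct .zero [.inl 0, .inl 1], fct .child [.inl 0, .inl 2], fct .pick [.inl 0, .inl 1, .inl 2],
    fct .brake [.inl 2], fct .zero [.inl 2, .inl 3], fct .num [.inl 2, .inl 3],
    fct .grow [.inl 2, .inl 3, .inl 2], fct .pick [.inl 2, .inl 3, .inl 2]]

theorem startDatabase_isDatabase : IsDatabase startDatabase := by
  simp [IsDatabase, startDatabase, factNullFree, fct]

theorem startDatabase_lastEra : LastEra (dbSet startDatabase) (.inl 2) (encode ([] : List ℕ)) where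
  finite := startDatabase.finite_toSet
  childless u := by simp [dbSet, startDatabase]
  brake := by simp [dbSet, startDatabase]
  start := ⟨.inl 3, by simp [dbSet, startDatabase]⟩
  parent := ⟨.inl 0, fun _ => .inl 1, by simp [dbSet, startDatabase]⟩

/-- If all prefixes of some sequence are rejected, there is an infinite fair derivation. -/
theorem exists_infinite_chase {c : Code} {a : ℕ} {R : ℕ → List ℕ → Bool} (hR : Decides c R)
    {f : ℕ → ℕ} (hf : ∀ k, R a ((List.range k).map f) = false) :
    ∃ C : Chase (ruleSet c a) (dbSet startDatabase), IsInfinite C ∧ Fair C := by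
  set L : ℕ → List ℕ := fun k => ((List.range k).map f).reverse with hL
  have hsucc : ∀ k, L (k + 1) = f k :: L k := fun k => by simp [hL, List.range_succ]
  have hrej : ∀ k, Rejected R a (L k) := by
    intro k
    induction k with
    | zero => exact rejected_nil.2 (hf 0)
    | succ k ih =>
      rw [hsucc, rejected_cons, ← hsucc]
      exact ⟨by simpa [hL] using hf (k + 1), ih⟩
  have hstep : ∀ k F, (∃ w, LastEra F w (encode (L k))) →
      ∃ F', (∃ w, LastEra F' w (encode (L (k + 1)))) ∧
        Relation.TransGen (ChaseStep (ruleSet c a)) F F' ∧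
        ∀ p ∈ (decode (Nat.unpair k).2 : Option (Rule × List Fact)), ∀ t : Trigger,
          instOf t = p → t.1 ∈ ruleSet c a → loaded t F → obsolete t F' := by
    rintro k F ⟨w, hw⟩
    have hk := hrej (k + 1)
    rw [hsucc] at hk ⊢
    by_cases ht : ∃ t : Trigger, instOf t ∈ (decode (Nat.unpair k).2 : Option (Rule × List Fact))
    · obtain ⟨t, ht⟩ := ht
      obtain ⟨F', w', h1, h2, h3⟩ := hw.next_obsolete hR hk t
      refine ⟨F', ⟨w', h2⟩, h1, ?_⟩
      rintro p hp t' rfl h4 h5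
      have htt : instOf t = instOf t' := Option.mem_unique ht hp
      have hr : t.1 = t'.1 := (Prod.mk.inj htt).1
      exact obsolete_congr htt (h3 (hr ▸ h4) (loaded_congr htt.symm h5))
    · obtain ⟨F', w', h1, h2, -⟩ := hw.next hR hk
      refine ⟨F', ⟨w', h2⟩, h1, ?_⟩
      rintro p hp t rfl
      exact absurd ⟨t, hp⟩ ht
  choose! next hn1 hn2 hn3 using hstep
  let F : ℕ → Set Fact := fun k => Nat.rec (dbSet startDatabase) next k
  have hF : ∀ k, ∃ w, LastEra (F k) w (encode (L k)) := by
    intro k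
    induction k with
    | zero => exact ⟨_, startDatabase_lastEra⟩
    | succ k ih => exact hn1 k (F k) ih
  exact exists_fair_chase (F := F) (fun k => hn2 k (F k) (hF k)) fun k => hn3 k (F k) (hF k)

/-- Membership in `TRR∀` is `Π¹₁`-hard. -/
theorem TRRall_Pi11Hard : Pi11Hard TRRall := by
  rintro q ⟨R, hR, hq⟩
  obtain ⟨c, hc⟩ := exists_decides hR
  refine ⟨ruleSet c, ruleSet_computable c, fun a => ⟨fun hqa => ?_, fun h => ?_⟩⟩
  · refine ⟨ruleSet_isRuleSet c a, ?_⟩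
    rintro D hD ⟨C, hC, hF⟩
    obtain ⟨f, hf⟩ := exists_rejected hC hF hc hD D.finite_toSet
    obtain ⟨k, hk⟩ := (hq a).1 hqa f
    simp [hf k] at hk
  · rw [hq]
    by_contra! hf
    obtain ⟨f, hf⟩ := hf
    exact h.2 _ startDatabase_isDatabase
      (exists_infinite_chase hc fun k => Bool.eq_false_of_not_eq_true (hf k))

end ChaseTermination
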